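/- arXiv:0810.4433 — 7 statements merged into one kernel-verified Lean document; each statement's English description precedes it below -/
import Mathlib

section
/- Let α ∈ ℂ with α ≠ 0 and α ≠ 1, let U ⊆ ℂ be a nonempty open connected set, and let f : ℂ → ℂ be continuous on U and satisfy the cross-ratio condition φ(α) on U. Then either f is constant on U, or there exist a, b, c, d ∈ ℂ with a·d − b·c ≠ 0 such that either (for all z ∈ U, c·z + d ≠ 0 and f z = (a·z + b)/(c·z + d)) or (for all z ∈ U, c·(conj z) + d ≠ 0 and f z = (a·(conj z) + b)/(c·(conj z) + d)); that is, f is the restriction to U of a Möbius transformation of the extended plane. -/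
/-- `f` satisfies the cross-ratio condition φ(α) on `U`: every quadruple of
pairwise distinct points of `U` with cross ratio `α` is mapped to a quadruple
with cross ratio `α` (finite-valued planar form). -/
def CrossRatioCond (α : ℂ) (U : Set ℂ) (f : ℂ → ℂ) : Prop :=
  ∀ z₁ ∈ U, ∀ z₂ ∈ U, ∀ z₃ ∈ U, ∀ z₄ ∈ U,
    z₁ ≠ z₂ → z₁ ≠ z₃ → z₁ ≠ z₄ → z₂ ≠ z₃ → z₂ ≠ z₄ → z₃ ≠ z₄ →
    (z₁ - z₃) * (z₂ - z₄) = α * ((z₃ - z₂) * (z₄ - z₁)) →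
    (f z₁ - f z₃) * (f z₂ - f z₄) = α * ((f z₃ - f z₂) * (f z₄ - f z₁))

open Filter Topology ComplexConjugate

/-- A map that is additive near the origin and continuous there agrees near the origin with a
continuous real-linear map. -/
lemma exists_continuousLinearMap_of_locally_additive {E F : Type*}
    [NormedAddCommGroup E] [NormedSpace ℝ E] [NormedAddCommGroup F] [NormedSpace ℝ F]
    {G : E → F} {δ : ℝ} (hδ : 0 < δ)
    (hadd : ∀ u v, ‖u‖ < δ → ‖v‖ < δ → G (u + v) = G u + G v) (hc : ContinuousAt G 0) :
    ∃ L : E →L[ℝ] F, ∀ u, ‖u‖ < δ → G u = L u := by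
  have hhalf : ∀ (n : ℕ) (u : E), ‖u‖ < δ → (2 : ℝ) ^ n • G (((2 : ℝ) ^ n)⁻¹ • u) = G u := by
    intro n
    induction n with
    | zero => intro u _; simp
    | succ n ih =>
      intro u hu
      have h2 : ‖(2 : ℝ)⁻¹ • u‖ < δ := by
        rw [norm_smul]
        norm_num
        linarith [norm_nonneg u]
      have h3 := ih _ h2
      have h4 := hadd _ _ h2 h2
      rw [← add_smul, show (2 : ℝ)⁻¹ + 2⁻¹ = 1 by norm_num, one_smul] at h4
      rw [pow_succ, mul_inv, mul_comm ((2 : ℝ) ^ n) 2, mul_smul, mul_smul, h3, two_smul, h4]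
  have hsmall : ∀ x : E, ∀ᶠ n : ℕ in atTop, ‖((2 : ℝ) ^ n)⁻¹ • x‖ < δ := by
    intro x
    have h1 : Tendsto (fun n : ℕ => ((2 : ℝ) ^ n)⁻¹) atTop (𝓝 0) := by
      simpa using tendsto_pow_atTop_nhds_zero_of_lt_one (r := (2 : ℝ)⁻¹) (by norm_num)
        (by norm_num)
    have h2 : Tendsto (fun n : ℕ => ‖((2 : ℝ) ^ n)⁻¹ • x‖) atTop (𝓝 0) := by
      simpa using (h1.smul_const x).norm
    exact h2.eventually_lt_const hδ
  have hex : ∀ x : E, ∃ y : F, ∀ᶠ n : ℕ in atTop,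
      (2 : ℝ) ^ n • G (((2 : ℝ) ^ n)⁻¹ • x) = y := by
    intro x
    obtain ⟨m, hm⟩ := (hsmall x).exists
    refine ⟨(2 : ℝ) ^ m • G (((2 : ℝ) ^ m)⁻¹ • x), ?_⟩
    filter_upwards [eventually_ge_atTop m] with n hn
    obtain ⟨k, rfl⟩ := Nat.exists_eq_add_of_le hn
    rw [← hhalf k _ hm, smul_smul, smul_smul, pow_add, mul_inv, mul_comm ((2 : ℝ) ^ m)⁻¹]
  choose H hH using hex
  have hHadd : ∀ x y, H (x + y) = H x + H y := by
    intro x y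
    obtain ⟨n, h1, h2, h3, h4, h5⟩ := ((hH (x + y)).and ((hH x).and ((hH y).and
      ((hsmall x).and (hsmall y))))).exists
    rw [← h1, ← h2, ← h3, smul_add, hadd _ _ h4 h5, smul_add]
  have hHG : ∀ u, ‖u‖ < δ → G u = H u := by
    intro u hu
    obtain ⟨n, hn⟩ := (hH u).exists
    rw [← hn, hhalf n u hu]
  let A : E →+ F := AddMonoidHom.mk' H hHadd
  have hA : Continuous A := by
    refine continuous_of_continuousAt_zero A (hc.congr ?_)
    filter_upwards [Metric.ball_mem_nhds (0 : E) hδ] with u hu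
    exact hHG u (by simpa using hu)
  exact ⟨A.toRealLinearMap hA, hHG⟩

lemma exists_pos_norm_smul_lt {E : Type*} [NormedAddCommGroup E] [NormedSpace ℝ E]
    (u : E) {δ : ℝ} (hδ : 0 < δ) : ∃ t : ℝ, 0 < t ∧ ‖t • u‖ < δ := by
  have h1 : Tendsto (fun t : ℝ => ‖t • u‖) (𝓝[>] 0) (𝓝 0) := by
    have : ContinuousAt (fun t : ℝ => ‖t • u‖) 0 := by fun_prop
    simpa using this.tendsto.mono_left nhdsWithin_le_nhds
  obtain ⟨t, ht, ht'⟩ := ((h1.eventually_lt_const hδ).and self_mem_nhdsWithin).exists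
  exact ⟨t, ht', ht⟩

/-- A continuous local solution of the Jensen equation with complex weights `s`, `1 - s` is
real-affine, and its linear part commutes with multiplication by `s`. -/
lemma exists_affine_of_locally_jensen {g : ℂ → ℂ} {s w₀ : ℂ} {r : ℝ} (hr : 0 < r)
    (hs0 : s ≠ 0) (hs1 : 1 - s ≠ 0) (hg : ContinuousAt g w₀)
    (hJ : ∀ x ∈ Metric.ball w₀ r, ∀ y ∈ Metric.ball w₀ r,
      s * x + (1 - s) * y ∈ Metric.ball w₀ r →
      g (s * x + (1 - s) * y) = s * g x + (1 - s) * g y) :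
    ∃ L : ℂ →L[ℝ] ℂ, (∀ u, L (s * u) = s * L u) ∧
      ∀ᶠ w in 𝓝 w₀, g w = g w₀ + L (w - w₀) := by
  set G : ℂ → ℂ := fun u => g (w₀ + u) - g w₀ with hG
  have hJ' : ∀ u v : ℂ, ‖u‖ < r → ‖v‖ < r → ‖s * u + (1 - s) * v‖ < r →
      G (s * u + (1 - s) * v) = s * G u + (1 - s) * G v := by
    intro u v hu hv huv
    have e : s * (w₀ + u) + (1 - s) * (w₀ + v) = w₀ + (s * u + (1 - s) * v) := by ring
    have := hJ (w₀ + u) (by simpa using hu) (w₀ + v) (by simpa using hv)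
      (by rw [e]; simpa using huv)
    rw [e] at this
    simp only [hG, this]
    ring
  have hG0 : G 0 = 0 := by simp [hG]
  have hs : ∀ u : ℂ, ‖u‖ < r → ‖s * u‖ < r → G (s * u) = s * G u := by
    intro u hu hu'
    simpa [hG0] using hJ' u 0 hu (by simpa using hr) (by simpa using hu')
  have hs' : ∀ u : ℂ, ‖u‖ < r → ‖(1 - s) * u‖ < r → G ((1 - s) * u) = (1 - s) * G u := by
    intro u hu hu'
    simpa [hG0] using hJ' 0 u (by simpa using hr) hu (by simpa using hu')
  set M : ℝ := 1 + ‖s⁻¹‖ + ‖(1 - s)⁻¹‖ with hM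
  have hM1 : 1 ≤ M := by linarith [norm_nonneg s⁻¹, norm_nonneg (1 - s)⁻¹]
  have hδ : 0 < r / (2 * M) := by positivity
  have hδM : r / (2 * M) * M = r / 2 := by field_simp
  have hle : ∀ (c u : ℂ), ‖c‖ ≤ M → ‖u‖ < r / (2 * M) → ‖c * u‖ < r / 2 := by
    intro c u hc hu
    rw [norm_mul, ← hδM]
    nlinarith [norm_nonneg c, norm_nonneg u]
  have hadd : ∀ u v, ‖u‖ < r / (2 * M) → ‖v‖ < r / (2 * M) → G (u + v) = G u + G v := by
    intro u v hu hv
    have hu1 := hle 1 u (by simpa using hM1) hu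
    have hv1 := hle 1 v (by simpa using hM1) hv
    have hu2 := hle s⁻¹ u (by linarith [norm_nonneg (1 - s)⁻¹]) hu
    have hv2 := hle (1 - s)⁻¹ v (by linarith [norm_nonneg s⁻¹]) hv
    rw [one_mul] at hu1 hv1
    have e1 : s * (s⁻¹ * u) = u := mul_inv_cancel_left₀ hs0 u
    have e2 : (1 - s) * ((1 - s)⁻¹ * v) = v := mul_inv_cancel_left₀ hs1 v
    have h1 := hJ' (s⁻¹ * u) ((1 - s)⁻¹ * v) (by linarith) (by linarith)
      (by rw [e1, e2]; linarith [norm_add_le u v])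
    have h2 := hs (s⁻¹ * u) (by linarith) (by rw [e1]; linarith)
    have h3 := hs' ((1 - s)⁻¹ * v) (by linarith) (by rw [e2]; linarith)
    rw [e1] at h2
    rw [e2] at h3
    rw [e1, e2] at h1
    rw [h1, h2, h3]
  have hGc : ContinuousAt G 0 := by
    have : ContinuousAt g (w₀ + 0) := by simpa using hg
    exact (this.comp (f := fun u => w₀ + u) (by fun_prop)).sub continuousAt_const
  obtain ⟨L, hL⟩ := exists_continuousLinearMap_of_locally_additive hδ hadd hGc
  have hδr : r / (2 * M) ≤ r := div_le_self hr.le (by linarith)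
  refine ⟨L, fun u => ?_, ?_⟩
  · obtain ⟨t, ht, htu⟩ := exists_pos_norm_smul_lt ((u, s * u) : ℂ × ℂ) hδ
    have h1 : ‖t • u‖ < r / (2 * M) := (norm_fst_le _).trans_lt htu
    have h2 : ‖t • (s * u)‖ < r / (2 * M) := (norm_snd_le _).trans_lt htu
    have e : t • (s * u) = s * t • u := (mul_smul_comm t s u).symm
    have h3 := hs (t • u) (by linarith) (by rw [← e]; linarith)
    rw [← e, hL _ h1, hL _ h2, map_smul, map_smul, mul_smul_comm] at h3
    exact smul_right_injective ℂ ht.ne' h3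
  · filter_upwards [Metric.ball_mem_nhds w₀ hδ] with w hw
    have := hL (w - w₀) (by simpa [dist_eq_norm] using hw)
    rw [← this]
    simp [hG]

lemma exists_eq_mul_add_mul_conj (L : ℂ →L[ℝ] ℂ) : ∃ p q : ℂ, ∀ w, L w = p * w + q * conj w := by
  refine ⟨(L 1 - Complex.I * L Complex.I) / 2, (L 1 + Complex.I * L Complex.I) / 2, fun w => ?_⟩
  have h : L w = w.re * L 1 + w.im * L Complex.I := by
    have : w = w.re • (1 : ℂ) + w.im • Complex.I := by simp [Complex.re_add_im]
    conv_lhs => rw [this, map_add, map_smul, map_smul]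
    simp
  rw [h]
  have h1 : (w.re : ℂ) = (w + conj w) / 2 := by simp [Complex.add_conj]
  have h2 : (w.im : ℂ) = (w - conj w) / (2 * Complex.I) := by
    simp [Complex.sub_conj]; field_simp
  rw [h1, h2]
  field_simp
  ring_nf
  simp only [Complex.I_sq]
  ring

/-- A real-linear map preserving the cross ratio `α` is complex linear or conjugate linear. -/
lemma eq_zero_or_eq_zero_of_crossRatioCond {α p q : ℂ} (hα0 : α ≠ 0) (hα1 : α ≠ 1)
    (hs : ∀ u, p * ((1 - α)⁻¹ * u) + q * conj ((1 - α)⁻¹ * u)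
      = (1 - α)⁻¹ * (p * u + q * conj u))
    (hL : CrossRatioCond α Set.univ fun w => p * w + q * conj w) : p = 0 ∨ q = 0 := by
  by_cases hα : conj α = α
  · obtain ⟨t, rfl⟩ := Complex.conj_eq_iff_real.1 hα
    have ht0 : t ≠ 0 := by exact_mod_cast hα0
    have ht1 : 1 - t ≠ 0 := sub_ne_zero.2 fun h => hα1 (by simp [← h])
    have ht2 : 1 + t ^ 2 ≠ 0 := by positivity
    have key := hL (1 + t ^ 2) trivial (-Complex.I * (1 + t ^ 2)) trivial
      ((1 - t) * (1 + t * Complex.I)) trivial 0 trivial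
      (fun h => by
        have := congrArg Complex.re h
        simp [← Complex.ofReal_pow] at this
        exact ht2 this)
      (fun h => by
        have := congrArg Complex.im h
        simp [← Complex.ofReal_pow] at this
        tauto)
      (fun h => by
        have := congrArg Complex.re h
        simp [← Complex.ofReal_pow] at this
        exact ht2 this)
      (fun h => by
        have := congrArg Complex.re h
        simp [← Complex.ofReal_pow] at this
        exact ht1 this.symm)
      (fun h => by
        have := congrArg Complex.im h
        simp [← Complex.ofReal_pow] at this
        exact ht2 (by linarith))
      (fun h => by
        have := congrArg Complex.re h
        simp at this
        exact ht1 this)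
      (by linear_combination ((t : ℂ) * (1 - t) * (1 + t ^ 2)) * Complex.I_sq)
    simp only [map_mul, map_add, map_sub, map_neg, map_pow, map_one, map_zero, Complex.conj_ofReal,
      Complex.conj_I] at key
    have : (4 * t * (1 - t) * (1 + t ^ 2) : ℂ) * (p * q) = 0 := by
      linear_combination key - (t * (1 - t) * (1 + t ^ 2) * (p - q) ^ 2) * Complex.I_sq
    have h4 : (4 * t * (1 - t) * (1 + t ^ 2) : ℂ) ≠ 0 := by
      exact_mod_cast mul_ne_zero (mul_ne_zero (mul_ne_zero four_ne_zero ht0) ht1) ht2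
    exact mul_eq_zero.1 ((mul_eq_zero.1 this).resolve_left h4)
  · right
    have h1 : 1 - α ≠ 0 := sub_ne_zero.2 hα1.symm
    have h2 : 1 - conj α ≠ 0 := fun h => h1 (by simpa using congrArg conj h)
    have h := hs 1
    simp only [mul_one, map_one, map_inv₀, map_sub] at h
    field_simp at h
    have : q * (conj α - α) = 0 := by linear_combination h
    exact (mul_eq_zero.1 this).resolve_right (sub_ne_zero.2 hα)

/-- The cross-ratio condition is inherited by `w ↦ (f (b + w⁻¹) - f b)⁻¹`. -/
lemma CrossRatioCond.inv_comp_inv {α b : ℂ} {U V : Set ℂ} {f : ℂ → ℂ} (hφ : CrossRatioCond α U f)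
    (hV : ∀ w ∈ V, w ≠ 0 ∧ b + w⁻¹ ∈ U ∧ f (b + w⁻¹) - f b ≠ 0) :
    CrossRatioCond α V fun w => (f (b + w⁻¹) - f b)⁻¹ := by
  intro w₁ h₁ w₂ h₂ w₃ h₃ w₄ h₄ h12 h13 h14 h23 h24 h34 h
  obtain ⟨n₁, u₁, f₁⟩ := hV _ h₁
  obtain ⟨n₂, u₂, f₂⟩ := hV _ h₂
  obtain ⟨n₃, u₃, f₃⟩ := hV _ h₃
  obtain ⟨n₄, u₄, f₄⟩ := hV _ h₄
  have inj : ∀ {x y : ℂ}, x ≠ y → b + x⁻¹ ≠ b + y⁻¹ := fun hxy e =>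
    hxy (inv_injective (add_left_cancel e))
  have key := hφ _ u₁ _ u₂ _ u₃ _ u₄ (inj h12) (inj h13) (inj h14) (inj h23) (inj h24) (inj h34)
    (by field_simp; linear_combination h)
  beta_reduce
  generalize f (b + w₁⁻¹) = y₁ at *
  generalize f (b + w₂⁻¹) = y₂ at *
  generalize f (b + w₃⁻¹) = y₃ at *
  generalize f (b + w₄⁻¹) = y₄ at *
  field_simp
  linear_combination key

/-- Sending the fourth point of the cross ratio to infinity turns the cross-ratio condition into
the Jensen equation with weight `(1 - α)⁻¹`. -/
lemma CrossRatioCond.jensen {α b : ℂ} {U V : Set ℂ} {f : ℂ → ℂ} (hφ : CrossRatioCond α U f)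
    (hα0 : α ≠ 0) (hα1 : α ≠ 1) (hb : b ∈ U)
    (hV : ∀ w ∈ V, w ≠ 0 ∧ b + w⁻¹ ∈ U ∧ f (b + w⁻¹) - f b ≠ 0) {x y : ℂ} (hx : x ∈ V) (hy : y ∈ V)
    (hxy : (1 - α)⁻¹ * x + (1 - (1 - α)⁻¹) * y ∈ V) :
    (f (b + ((1 - α)⁻¹ * x + (1 - (1 - α)⁻¹) * y)⁻¹) - f b)⁻¹ =
      (1 - α)⁻¹ * (f (b + x⁻¹) - f b)⁻¹ + (1 - (1 - α)⁻¹) * (f (b + y⁻¹) - f b)⁻¹ := by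
  have hα : 1 - α ≠ 0 := sub_ne_zero.2 hα1.symm
  rcases eq_or_ne x y with rfl | hne
  · rw [← add_mul, ← add_mul, add_sub_cancel, one_mul, one_mul]
  set v := (1 - α)⁻¹ * x + (1 - (1 - α)⁻¹) * y with hv
  have hv' : (1 - α) * v = x - α * y := by rw [hv]; field_simp; ring
  have hxv : x ≠ v := by
    intro e
    rw [← e] at hv'
    exact hne (mul_left_cancel₀ hα0 (by linear_combination -hv'))
  have hyv : y ≠ v := by
    intro e
    rw [← e] at hv'
    exact hne (by linear_combination -hv')
  obtain ⟨n₁, u₁, f₁⟩ := hV _ hx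
  obtain ⟨n₂, u₂, f₂⟩ := hV _ hy
  obtain ⟨n₃, u₃, f₃⟩ := hV _ hxy
  have inj : ∀ {x y : ℂ}, x ≠ y → b + x⁻¹ ≠ b + y⁻¹ := fun hxy e =>
    hxy (inv_injective (add_left_cancel e))
  have hbne : ∀ {x : ℂ}, x ≠ 0 → b + x⁻¹ ≠ b := fun hx e =>
    inv_ne_zero hx (by simpa using e)
  have key := hφ _ u₁ _ u₂ _ u₃ b hb (inj hne) (inj hxv) (hbne n₁) (inj hyv) (hbne n₂) (hbne n₃)
    (by field_simp; linear_combination hv')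
  clear_value v
  generalize f (b + x⁻¹) = y₁ at *
  generalize f (b + y⁻¹) = y₂ at *
  generalize f (b + v⁻¹) = y₃ at *
  field_simp
  linear_combination key

/-- Near a point `a` with `f a ≠ f b`, a continuous map satisfying the cross-ratio condition is
given by a possibly degenerate Möbius or anti-Möbius formula. -/
lemma CrossRatioCond.exists_local_form {α a b : ℂ} {U : Set ℂ} {f : ℂ → ℂ}
    (hφ : CrossRatioCond α U f) (hα0 : α ≠ 0) (hα1 : α ≠ 1) (hU : IsOpen U)
    (hf : ContinuousOn f U) (ha : a ∈ U) (hb : b ∈ U) (hab : f a ≠ f b) :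
    ∃ (σ : ℂ →+* ℂ) (A p : ℂ), (σ = RingHom.id ℂ ∨ σ = starRingEnd ℂ) ∧
      ∀ᶠ z in 𝓝 a, A * (σ z - σ b) + p ≠ 0 ∧
        f z = f b + (σ z - σ b) / (A * (σ z - σ b) + p) := by
  have hne : a - b ≠ 0 := sub_ne_zero.2 fun h => hab (by rw [h])
  set w₀ := (a - b)⁻¹ with hw₀
  have hw₀0 : w₀ ≠ 0 := inv_ne_zero hne
  have hm₀ : b + w₀⁻¹ = a := by simp [hw₀]
  have hm : ContinuousAt (fun w : ℂ => b + w⁻¹) w₀ :=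
    continuousAt_const.add (continuousAt_inv₀ hw₀0)
  have hfa : ContinuousAt f (b + w₀⁻¹) := by
    rw [hm₀]
    exact hf.continuousAt (hU.mem_nhds ha)
  have hfm : ContinuousAt (fun w : ℂ => f (b + w⁻¹) - f b) w₀ :=
    (hfa.comp (f := fun w : ℂ => b + w⁻¹) hm).sub continuousAt_const
  have hfm₀ : f (b + w₀⁻¹) - f b ≠ 0 := by rwa [hm₀, sub_ne_zero]
  have hev : ∀ᶠ w in 𝓝 w₀, w ≠ 0 ∧ b + w⁻¹ ∈ U ∧ f (b + w⁻¹) - f b ≠ 0 :=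
    (eventually_ne_nhds hw₀0).and ((hm.eventually_mem (hU.mem_nhds (by rwa [hm₀]))).and
      (hfm.eventually_ne hfm₀))
  obtain ⟨r, hr, hV⟩ := Metric.eventually_nhds_iff_ball.1 hev
  set g : ℂ → ℂ := fun w => (f (b + w⁻¹) - f b)⁻¹ with hg
  have hα : 1 - α ≠ 0 := sub_ne_zero.2 hα1.symm
  have hs1 : 1 - (1 - α)⁻¹ ≠ 0 := by
    intro h
    field_simp at h
    exact hα0 (by linear_combination -h)
  obtain ⟨L, hLs, hL⟩ := exists_affine_of_locally_jensen (g := g) hr (inv_ne_zero hα) hs1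
    (hfm.inv₀ hfm₀) fun x hx y hy hxy => hφ.jensen hα0 hα1 hb hV hx hy hxy
  have hLφ : CrossRatioCond α Set.univ L := by
    intro w₁ _ w₂ _ w₃ _ w₄ _ h12 h13 h14 h23 h24 h34 h
    obtain ⟨δ, hδ, hball⟩ := Metric.eventually_nhds_iff_ball.1 hL
    obtain ⟨t, ht, hsmall⟩ := exists_pos_norm_smul_lt ((w₁, w₂, w₃, w₄) : ℂ × ℂ × ℂ × ℂ)
      (lt_min hδ hr)
    simp only [Prod.smul_mk, Prod.norm_mk, max_lt_iff, lt_min_iff] at hsmall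
    obtain ⟨⟨d₁, d₂, d₃, d₄⟩, r₁, r₂, r₃, r₄⟩ := hsmall
    have hmem : ∀ {w : ℂ} {ε : ℝ}, ‖t • w‖ < ε → w₀ + t • w ∈ Metric.ball w₀ ε := by
      intro w ε hw
      simpa using hw
    have ht' : (t : ℂ) ≠ 0 := by exact_mod_cast ht.ne'
    have inj : ∀ {x y : ℂ}, x ≠ y → w₀ + t • x ≠ w₀ + t • y := fun hxy e =>
      hxy (smul_right_injective ℂ ht.ne' (add_left_cancel e))
    have hgL : ∀ {w : ℂ}, ‖t • w‖ < δ → g (w₀ + t • w) = g w₀ + t * L w := by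
      intro w hw
      rw [hball _ (hmem hw), add_sub_cancel_left, map_smul, Complex.real_smul]
    have key := hφ.inv_comp_inv hV _ (hmem r₁) _ (hmem r₂) _ (hmem r₃) _ (hmem r₄)
      (inj h12) (inj h13) (inj h14) (inj h23) (inj h24) (inj h34)
      (by simp only [Complex.real_smul]; linear_combination (t : ℂ) ^ 2 * h)
    change (g _ - g _) * (g _ - g _) = α * ((g _ - g _) * (g _ - g _)) at key
    rw [hgL d₁, hgL d₂, hgL d₃, hgL d₄] at key
    refine mul_left_cancel₀ (pow_ne_zero 2 ht') ?_
    linear_combination key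
  obtain ⟨σ, p, hσ, hLσ⟩ : ∃ (σ : ℂ →+* ℂ) (p : ℂ), (σ = RingHom.id ℂ ∨ σ = starRingEnd ℂ) ∧
      ∀ w, L w = p * σ w := by
    obtain ⟨p, q, hpq⟩ := exists_eq_mul_add_mul_conj L
    rw [funext hpq] at hLφ
    rcases eq_zero_or_eq_zero_of_crossRatioCond hα0 hα1 (fun u => by rw [← hpq, ← hpq, hLs])
      hLφ with rfl | rfl
    · exact ⟨starRingEnd ℂ, q, Or.inr rfl, by simpa using hpq⟩
    · exact ⟨RingHom.id ℂ, p, Or.inl rfl, by simpa using hpq⟩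
  refine ⟨σ, g w₀ - L w₀, p, hσ, ?_⟩
  have hinv : Tendsto (fun z : ℂ => (z - b)⁻¹) (𝓝 a) (𝓝 w₀) :=
    ContinuousAt.inv₀ (f := fun z : ℂ => z - b) (by fun_prop) hne
  filter_upwards [hinv.eventually (hL.and hev)] with z hz
  obtain ⟨hz, hz0, -, hfz⟩ := hz
  have hzb : σ z - σ b ≠ 0 := by
    rw [← map_sub, Ne, map_eq_zero]
    exact fun h => hz0 (by rw [h, inv_zero])
  have hgz : g (z - b)⁻¹ = (f z - f b)⁻¹ := by simp [hg]
  simp only [inv_inv, add_sub_cancel] at hfz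
  rw [hgz, map_sub, hLσ (z - b)⁻¹, map_inv₀, map_sub] at hz
  have h1 : (g w₀ - L w₀) * (σ z - σ b) + p = (σ z - σ b) * (f z - f b)⁻¹ := by
    rw [hz]
    field_simp
    ring
  rw [h1]
  refine ⟨mul_ne_zero hzb (inv_ne_zero hfz), ?_⟩
  field_simp
  ring

theorem moebius_of_crossRatioCond
    (α : ℂ) (hα0 : α ≠ 0) (hα1 : α ≠ 1)
    (U : Set ℂ) (hUne : U.Nonempty) (hUopen : IsOpen U) (hUconn : IsConnected U)
    (f : ℂ → ℂ) (hf : ContinuousOn f U) (hφ : CrossRatioCond α U f) :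
    (∃ w : ℂ, ∀ z ∈ U, f z = w) ∨
    ∃ a b c d : ℂ, a * d - b * c ≠ 0 ∧
      ((∀ z ∈ U, c * z + d ≠ 0 ∧ f z = (a * z + b) / (c * z + d)) ∨
       (∀ z ∈ U, c * (starRingEnd ℂ z) + d ≠ 0 ∧
          f z = (a * (starRingEnd ℂ z) + b) / (c * (starRingEnd ℂ z) + d))) := by
  by_cases hconst : ∃ w : ℂ, ∀ z ∈ U, f z = w
  · exact Or.inl hconst
  right
  have hloc : ∀ a ∈ U, ∃ (b : ℂ) (σ : ℂ →+* ℂ) (A p : ℂ),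
      (σ = RingHom.id ℂ ∨ σ = starRingEnd ℂ) ∧
      ∀ᶠ z in 𝓝 a, A * (σ z - σ b) + p ≠ 0 ∧
        f z = f b + (σ z - σ b) / (A * (σ z - σ b) + p) := by
    intro a ha
    obtain ⟨b, hb, hab⟩ : ∃ b ∈ U, f a ≠ f b := by
      by_contra! h
      exact hconst ⟨f a, fun z hz => (h z hz).symm⟩
    exact ⟨b, hφ.exists_local_form hα0 hα1 hUopen hf ha hb hab⟩
  have hσan : ∀ {σ : ℂ →+* ℂ}, (σ = RingHom.id ℂ ∨ σ = starRingEnd ℂ) →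
      ∀ z, AnalyticAt ℝ σ z := by
    rintro σ (rfl | rfl) z
    · exact analyticAt_id
    · exact Complex.conjCLE.toContinuousLinearMap.analyticAt z
  have hfan : AnalyticOnNhd ℝ f U := by
    intro a ha
    obtain ⟨b, σ, A, p, hσ, h⟩ := hloc a ha
    have hσa : AnalyticAt ℝ (fun z => σ z - σ b) a := (hσan hσ a).sub analyticAt_const
    refine AnalyticAt.congr (f := fun z => f b + (σ z - σ b) / (A * (σ z - σ b) + p)) ?_
      (h.mono fun z hz => hz.2.symm)
    exact analyticAt_const.add (hσa.div ((analyticAt_const.mul hσa).add analyticAt_const)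
      h.self_of_nhds.1)
  obtain ⟨a, ha⟩ := hUne
  obtain ⟨b, σ, A, p, hσ, h⟩ := hloc a ha
  have hp : p ≠ 0 := by
    rintro rfl
    refine hconst ⟨f b + A⁻¹, hfan.eqOn_of_preconnected_of_eventuallyEq analyticOnNhd_const
      hUconn.isPreconnected ha ?_⟩
    filter_upwards [h] with z hz
    obtain ⟨hz0, hz⟩ := hz
    rw [add_zero] at hz0 hz
    have h1 := left_ne_zero_of_mul hz0
    have h2 := right_ne_zero_of_mul hz0
    rw [hz]
    field_simp
  have hpoly : Set.EqOn (fun z => (A * σ z + (p - A * σ b)) * f z)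
      (fun z => (f b * A + 1) * σ z + (f b * (p - A * σ b) - σ b)) U := by
    refine AnalyticOnNhd.eqOn_of_preconnected_of_eventuallyEq (𝕜 := ℝ) (z₀ := a)
      (fun z hz => ((analyticAt_const.mul (hσan hσ z)).add analyticAt_const).mul (hfan z hz))
      (fun z _ => (analyticAt_const.mul (hσan hσ z)).add analyticAt_const)
      hUconn.isPreconnected ha ?_
    filter_upwards [h] with z hz
    obtain ⟨hz0, hz⟩ := hz
    rw [hz]
    field_simp
    ring
  have hdet : (f b * A + 1) * (p - A * σ b) - (f b * (p - A * σ b) - σ b) * A ≠ 0 := by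
    convert hp using 1
    ring
  have hfin : ∀ z ∈ U, A * σ z + (p - A * σ b) ≠ 0 ∧
      f z = ((f b * A + 1) * σ z + (f b * (p - A * σ b) - σ b)) / (A * σ z + (p - A * σ b)) := by
    intro z hz
    have e := hpoly hz
    simp only at e
    have h0 : A * σ z + (p - A * σ b) ≠ 0 := by
      intro h0
      rw [h0, zero_mul] at e
      exact hp (by linear_combination (f b * A + 1) * h0 + A * e)
    exact ⟨h0, by rw [← e, mul_div_cancel_left₀ _ h0]⟩
  refine ⟨_, _, _, _, hdet, ?_⟩
  rcases hσ with rfl | rfl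
  · exact Or.inl hfin
  · exact Or.inr hfin
end

section
/- Let α ∈ ℂ be non-real (α ∉ ℝ), let U ⊆ ℂ be a nonempty open connected set, and let f : ℂ → ℂ be continuous on U and satisfy the cross-ratio condition φ(α) on U. Then either f is constant on U, or there exist a, b, c, d ∈ ℂ with a·d − b·c ≠ 0 such that for all z ∈ U, c·z + d ≠ 0 and f z = (a·z + b)/(c·z + d); that is, f is the restriction to U of a linear-fractional (orientation-preserving Möbius) transformation. -/
open Filter Topology

/-- A map that is additive on a ball around `0` and continuous at `0` agrees on that ball with a
real-linear map. -/
theorem exists_realLinear_of_locally_additive {A : ℂ → ℂ} {r : ℝ} (hr : 0 < r)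
    (hA : ContinuousAt A 0)
    (hadd : ∀ x y, ‖x‖ < r → ‖y‖ < r → A (x + y) = A x + A y) :
    ∃ L : ℂ →L[ℝ] ℂ, ∀ x, ‖x‖ < r → A x = L x := by
  have norm_div_le : ∀ (x : ℂ) (k : ℕ), ‖x / 2 ^ k‖ ≤ ‖x‖ := fun x k => by
    rw [norm_div, norm_pow, Complex.norm_ofNat]
    exact div_le_self (norm_nonneg _) (one_le_pow₀ (by norm_num))
  have hpow : ∀ (k : ℕ) (x : ℂ), ‖x‖ < r → A x = 2 ^ k * A (x / 2 ^ k) := by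
    intro k
    induction k with
    | zero => simp
    | succ k ih =>
      intro x hx
      have hy : ‖x / 2 ^ (k + 1)‖ < r := (norm_div_le x _).trans_lt hx
      have h := hadd _ _ hy hy
      have e : x / 2 ^ (k + 1) + x / 2 ^ (k + 1) = x / 2 ^ k := by rw [pow_succ]; field_simp; norm_num
      rw [e] at h
      rw [ih x hx, h]
      ring
  have hex : ∀ z : ℂ, ∃ n : ℕ, ‖z / 2 ^ n‖ < r := by
    intro z
    obtain ⟨n, hn⟩ := pow_unbounded_of_one_lt (‖z‖ / r) (one_lt_two : (1 : ℝ) < 2)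
    refine ⟨n, ?_⟩
    rw [norm_div, norm_pow, Complex.norm_ofNat, div_lt_iff₀ (by positivity)]
    rwa [div_lt_iff₀ hr, mul_comm] at hn
  choose n hn using hex
  have hB : ∀ z m, ‖z / 2 ^ m‖ < r → 2 ^ n z * A (z / 2 ^ n z) = 2 ^ m * A (z / 2 ^ m) := by
    intro z m hm
    rw [hpow m _ (hn z), hpow (n z) _ hm, div_div, div_div, mul_comm ((2 : ℂ) ^ m) (2 ^ n z)]
    ring
  have hshrink : ∀ (z : ℂ) (m k : ℕ), m ≤ k → ‖z / 2 ^ m‖ < r → ‖z / 2 ^ k‖ < r := by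
    intro z m k hmk h
    obtain ⟨j, rfl⟩ := Nat.exists_eq_add_of_le hmk
    rw [pow_add, ← div_div]
    exact (norm_div_le _ j).trans_lt h
  let B : ℂ →+ ℂ := AddMonoidHom.mk' (fun z => 2 ^ n z * A (z / 2 ^ n z)) (by
    intro x y
    set k := max (n (x + y)) (max (n x) (n y))
    have hx : ‖x / 2 ^ k‖ < r := hshrink x (n x) k (by simp [k]) (hn x)
    have hy : ‖y / 2 ^ k‖ < r := hshrink y (n y) k (by simp [k]) (hn y)
    have hxy : ‖(x + y) / 2 ^ k‖ < r := hshrink _ (n (x + y)) k (by simp [k]) (hn _)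
    simp only [hB x k hx, hB y k hy, hB (x + y) k hxy]
    rw [add_div, hadd _ _ hx hy, mul_add])
  have hBA : ∀ x, ‖x‖ < r → A x = B x := by
    intro x hx
    have := hB x 0 (by simpa using hx)
    simp only [pow_zero, div_one, one_mul] at this
    exact this.symm
  have hBc : Continuous B := by
    refine continuous_of_continuousAt_zero B (hA.congr ?_)
    filter_upwards [Metric.ball_mem_nhds (0 : ℂ) hr] with x hx
    exact hBA x (by simpa using hx)
  exact ⟨B.toRealLinearMap hBc, hBA⟩

theorem realLinear_eq_mul_of_map_smul {L : ℂ →L[ℝ] ℂ} {c : ℂ} (hc : c.im ≠ 0)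
    {r : ℝ} (hr : 0 < r) (hL : ∀ x, ‖x‖ < r → L (c * x) = c * L x) (x : ℂ) :
    L x = x * L 1 := by
  have hLr : ∀ (t : ℝ) (z : ℂ), L (t * z) = t * L z := fun t z => by
    simpa using L.map_smul t z
  have hc1 : L c = c * L 1 := by
    have h := hL ((r / 2 : ℝ) * 1) (by
      rw [mul_one, Complex.norm_real, Real.norm_of_nonneg (by positivity)]; linarith)
    rw [mul_left_comm, hLr, hLr, mul_one, mul_left_comm] at h
    exact mul_left_cancel₀ (by exact_mod_cast (by positivity : r / 2 ≠ 0)) h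
  have hdecomp : ∀ z : ℂ, L z = z.re * L 1 + z.im * L Complex.I := fun z => by
    conv_lhs => rw [← Complex.re_add_im z, map_add, hLr, ← mul_one (z.re : ℂ), hLr]
  have hI : L Complex.I = Complex.I * L 1 := by
    rw [hdecomp c] at hc1
    have hc' : (c.im : ℂ) ≠ 0 := by exact_mod_cast hc
    refine mul_left_cancel₀ hc' ?_
    linear_combination hc1 - L 1 * Complex.re_add_im c
  rw [hdecomp x, hI]
  linear_combination L 1 * Complex.re_add_im x

/-- A map continuous at `w₀` that preserves affine combinations with one fixed nonreal weight near
`w₀` is complex affine near `w₀`. -/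
theorem eventually_affine_of_nonreal_weight {α : ℂ} (hα : α.im ≠ 0) {g : ℂ → ℂ} {w₀ : ℂ}
    (hg : ContinuousAt g w₀) {N : Set ℂ} (hN : N ∈ 𝓝 w₀)
    (h : ∀ w₁ ∈ N, ∀ w₂ ∈ N, ∀ w₃ ∈ N, (1 - α) * w₃ = w₁ - α * w₂ →
      (1 - α) * g w₃ = g w₁ - α * g w₂) :
    ∃ m k : ℂ, ∀ᶠ w in 𝓝 w₀, g w = m * w + k := by
  have hα0 : α ≠ 0 := by rintro rfl; simp at hα
  have hα1 : 1 - α ≠ 0 := by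
    intro h0
    rw [← sub_eq_zero.mp h0] at hα
    simp at hα
  set A : ℂ → ℂ := fun x => g (w₀ + x) - g w₀ with hAdef
  have hw₀ : w₀ ∈ N := mem_of_mem_nhds hN
  have hmul : ∀ c : ℂ, ∀ᶠ x in 𝓝 (0 : ℂ), w₀ + c * x ∈ N := fun c => by
    have : Tendsto (fun x : ℂ => w₀ + c * x) (𝓝 0) (𝓝 w₀) :=
      Continuous.tendsto' (by fun_prop) _ _ (by simp)
    exact this hN
  have hsum : ∀ᶠ q : ℂ × ℂ in 𝓝 0, w₀ + (q.1 + q.2) ∈ N := by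
    have : Tendsto (fun q : ℂ × ℂ => w₀ + (q.1 + q.2)) (𝓝 0) (𝓝 w₀) :=
      Continuous.tendsto' (by fun_prop) _ _ (by simp)
    exact this hN
  obtain ⟨r₁, hr₁, hr₁N⟩ := Metric.eventually_nhds_iff.mp hsum
  obtain ⟨r₂, hr₂, hr₂N⟩ := Metric.eventually_nhds_iff.mp
    (((hmul 1).and (hmul (1 - α))).and (hmul (-(1 - α) / α)))
  set r := min r₁ r₂
  have hr : 0 < r := lt_min hr₁ hr₂
  have hN' : ∀ x, ‖x‖ < r →
      w₀ + x ∈ N ∧ w₀ + (1 - α) * x ∈ N ∧ w₀ + (-(1 - α) / α) * x ∈ N := by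
    intro x hx
    have := @hr₂N x (by simpa using hx.trans_le (min_le_right _ _))
    simpa [and_assoc] using this
  have hA : ∀ x₁ x₂ x₃, w₀ + x₁ ∈ N → w₀ + x₂ ∈ N → w₀ + x₃ ∈ N →
      (1 - α) * x₃ = x₁ - α * x₂ → (1 - α) * A x₃ = A x₁ - α * A x₂ := by
    intro x₁ x₂ x₃ h₁ h₂ h₃ e
    have := h _ h₁ _ h₂ _ h₃ (by linear_combination e)
    simp only [hAdef]
    linear_combination this
  have hA0 : A 0 = 0 := by simp [hAdef]
  have hleft : ∀ x, ‖x‖ < r → A ((1 - α) * x) = (1 - α) * A x := by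
    intro x hx
    obtain ⟨h₁, h₂, -⟩ := hN' x hx
    have := hA _ 0 x h₂ (by simpa using hw₀) h₁ (by ring)
    rw [this, hA0]
    ring
  have hadd : ∀ x y, ‖x‖ < r → ‖y‖ < r → A (x + y) = A x + A y := by
    intro x y hx hy
    have hxy : w₀ + (x + y) ∈ N := by
      refine @hr₁N (x, y) ?_
      rw [dist_zero_right, Prod.norm_def]
      exact max_lt (hx.trans_le (min_le_left _ _)) (hy.trans_le (min_le_left _ _))
    obtain ⟨-, hx₂, -⟩ := hN' x hx
    obtain ⟨hy₁, -, hy₃⟩ := hN' y hy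
    have e₁ := hA _ _ (x + y) hx₂ hy₃ hxy (by field_simp; ring)
    have e₂ := hA 0 _ y (by simpa using hw₀) hy₃ hy₁ (by field_simp; ring)
    rw [hleft x hx] at e₁
    rw [hA0] at e₂
    refine mul_left_cancel₀ hα1 ?_
    linear_combination e₁ - e₂
  have hAc : ContinuousAt A 0 := by
    have : ContinuousAt g (w₀ + 0) := by simpa using hg
    exact (ContinuousAt.comp (f := fun x : ℂ => w₀ + x) this (by fun_prop)).sub continuousAt_const
  obtain ⟨L, hL⟩ := exists_realLinear_of_locally_additive hr hAc hadd
  set s := r / (1 + ‖1 - α‖)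
  have hs : 0 < s := by positivity
  have hLmul : ∀ x, L x = x * L 1 := by
    refine realLinear_eq_mul_of_map_smul (c := 1 - α) (by simpa using hα) hs fun x hx => ?_
    have hx' : ‖x‖ * (1 + ‖1 - α‖) < r := (lt_div_iff₀ (by positivity)).mp hx
    have h₁ : ‖x‖ < r := by nlinarith [norm_nonneg x, norm_nonneg (1 - α)]
    have h₂ : ‖(1 - α) * x‖ < r := by
      rw [norm_mul]; nlinarith [norm_nonneg x, norm_nonneg (1 - α)]
    rw [← hL _ h₁, ← hL _ h₂, hleft x h₁]
  refine ⟨L 1, g w₀ - L 1 * w₀, ?_⟩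
  filter_upwards [Metric.ball_mem_nhds w₀ hr] with w hw
  have := hL (w - w₀) (by simpa [dist_eq_norm] using hw)
  rw [hLmul] at this
  simp only [hAdef, add_sub_cancel] at this
  linear_combination this

/-- Near a point whose value differs from some other value, `f` satisfies a linear-fractional
relation. -/
theorem CrossRatioCond.eventually_linearFractional {α : ℂ} (hα : α.im ≠ 0) {U : Set ℂ}
    {f : ℂ → ℂ} (hφ : CrossRatioCond α U f) {z₀ p : ℂ} (hU : U ∈ 𝓝 z₀) (hp : p ∈ U)
    (hf : ContinuousAt f z₀) (hne : f z₀ ≠ f p) :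
    ∃ a b c d : ℂ, c * z₀ + d ≠ 0 ∧ ∀ᶠ z in 𝓝 z₀, f z * (c * z + d) = a * z + b := by
  have hα1 : 1 - α ≠ 0 := by
    intro h0
    rw [← sub_eq_zero.mp h0] at hα
    simp at hα
  have hα0 : α ≠ 0 := by rintro rfl; simp at hα
  have hz₀p : z₀ - p ≠ 0 := sub_ne_zero.mpr fun h => hne (h ▸ rfl)
  set ψ : ℂ → ℂ := fun w => p + w⁻¹
  have hψ₀ : ψ (z₀ - p)⁻¹ = z₀ := by simp [ψ]
  have hψc : ContinuousAt ψ (z₀ - p)⁻¹ :=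
    continuousAt_const.add (continuousAt_inv₀ (inv_ne_zero hz₀p))
  have hfψ : ContinuousAt (fun w => f (ψ w)) (z₀ - p)⁻¹ :=
    ContinuousAt.comp (by rwa [hψ₀]) hψc
  set g : ℂ → ℂ := fun w => (f (ψ w) - f p)⁻¹ with hg
  have hgc : ContinuousAt g (z₀ - p)⁻¹ :=
    (hfψ.sub continuousAt_const).inv₀ (by simpa [hψ₀] using sub_ne_zero.mpr hne)
  have hN : {w | w ≠ 0 ∧ ψ w ∈ U ∧ f (ψ w) ≠ f p} ∈ 𝓝 (z₀ - p)⁻¹ := by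
    have h₂ : ∀ᶠ w in 𝓝 (z₀ - p)⁻¹, ψ w ∈ U := hψc (by rwa [hψ₀])
    have h₃ : ∀ᶠ w in 𝓝 (z₀ - p)⁻¹, f (ψ w) ≠ f p := hfψ.eventually_ne (by rwa [hψ₀])
    filter_upwards [eventually_ne_nhds (inv_ne_zero hz₀p), h₂, h₃] with w h₁ h₂ h₃
      using ⟨h₁, h₂, h₃⟩
  obtain ⟨m, k, hmk⟩ := eventually_affine_of_nonreal_weight hα hgc hN (by
    rintro w₁ ⟨h₁, hU₁, hf₁⟩ w₂ ⟨h₂, hU₂, hf₂⟩ w₃ ⟨h₃, hU₃, hf₃⟩ e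
    rcases eq_or_ne w₁ w₂ with rfl | h₁₂
    · have : w₃ = w₁ := mul_left_cancel₀ hα1 (by linear_combination e)
      rw [this]; ring
    have h₁₃ : w₁ ≠ w₃ := by
      rintro rfl
      exact h₁₂ (mul_left_cancel₀ hα0 (by linear_combination -e))
    have h₂₃ : w₂ ≠ w₃ := by
      rintro rfl
      exact h₁₂ (by linear_combination -e)
    have hψinj : ∀ {x y : ℂ}, x ≠ y → ψ x ≠ ψ y := fun hxy h =>
      hxy (inv_injective (add_left_cancel h))
    have hψp : ∀ {x : ℂ}, x ≠ 0 → ψ x ≠ p := fun hx h => hx (by simpa [ψ] using h)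
    have key := hφ _ hU₁ _ hU₂ _ hU₃ _ hp (hψinj h₁₂) (hψinj h₁₃) (hψp h₁) (hψinj h₂₃)
      (hψp h₂) (hψp h₃) (by
        simp only [ψ]
        field_simp
        linear_combination e)
    have d₁ := sub_ne_zero.mpr hf₁
    have d₂ := sub_ne_zero.mpr hf₂
    have d₃ := sub_ne_zero.mpr hf₃
    simp only [hg]
    field_simp
    linear_combination key)
  refine ⟨1 + f p * k, f p * (m - k * p) - p, k, m - k * p, ?_⟩
  have hinv : ContinuousAt (fun z : ℂ => (z - p)⁻¹) z₀ :=
    (continuousAt_id.sub continuousAt_const).inv₀ hz₀p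
  have hrel : ∀ᶠ z in 𝓝 z₀, z - p ≠ 0 ∧ (f z - f p) * (m + k * (z - p)) = z - p := by
    filter_upwards [hinv.eventually hmk, hf.eventually_ne hne, eventually_ne_nhds
      (sub_ne_zero.mp hz₀p)] with z hz hfz hzp
    have hzp' := sub_ne_zero.mpr hzp
    have hfz' := sub_ne_zero.mpr hfz
    refine ⟨hzp', ?_⟩
    simp only [hg, ψ, inv_inv, add_sub_cancel] at hz
    field_simp at hz
    linear_combination -hz
  constructor
  · intro h0
    have h := hrel.self_of_nhds.2
    exact hz₀p (by linear_combination -h + (f z₀ - f p) * h0)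
  · filter_upwards [hrel] with z hz
    linear_combination hz.2

theorem linearFractional_of_crossRatioCond_nonreal
    (α : ℂ) (hα : α ∉ Set.range ((↑) : ℝ → ℂ))
    (U : Set ℂ) (hUne : U.Nonempty) (hUopen : IsOpen U) (hUconn : IsConnected U)
    (f : ℂ → ℂ) (hf : ContinuousOn f U) (hφ : CrossRatioCond α U f) :
    (∃ w : ℂ, ∀ z ∈ U, f z = w) ∨
    ∃ a b c d : ℂ, a * d - b * c ≠ 0 ∧
      ∀ z ∈ U, c * z + d ≠ 0 ∧ f z = (a * z + b) / (c * z + d) := by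
  have him : α.im ≠ 0 := fun h => hα ⟨α.re, Complex.ext rfl (by simp [h])⟩
  by_cases hconst : ∃ w : ℂ, ∀ z ∈ U, f z = w
  · exact Or.inl hconst
  have hloc : ∀ z ∈ U, ∃ a b c d : ℂ, c * z + d ≠ 0 ∧
      ∀ᶠ x in 𝓝 z, f x * (c * x + d) = a * x + b := by
    intro z hz
    have hp : ∃ p ∈ U, f z ≠ f p := by
      by_contra! h
      exact hconst ⟨f z, fun x hx => (h x hx).symm⟩
    obtain ⟨p, hp, hne⟩ := hp
    exact hφ.eventually_linearFractional him (hUopen.mem_nhds hz) hp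
      (hf.continuousAt (hUopen.mem_nhds hz)) hne
  have hden : ∀ c d z : ℂ, c * z + d ≠ 0 → ∀ᶠ x in 𝓝 z, c * x + d ≠ 0 := fun c d z h =>
    ContinuousAt.eventually_ne (by fun_prop) h
  have han : AnalyticOnNhd ℂ f U := by
    intro z hz
    obtain ⟨a, b, c, d, h0, h⟩ := hloc z hz
    have : AnalyticAt ℂ (fun x => (a * x + b) / (c * x + d)) z :=
      AnalyticAt.div (by fun_prop) (by fun_prop) h0
    refine this.congr ?_
    filter_upwards [h, hden c d z h0] with x hx hx0
    rw [← hx, mul_div_cancel_right₀ _ hx0]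
  obtain ⟨z₀, hz₀⟩ := hUne
  obtain ⟨a, b, c, d, h0, h⟩ := hloc z₀ hz₀
  have hdet : a * d - b * c ≠ 0 := by
    intro hdet
    refine hconst ⟨f z₀, ?_⟩
    refine han.eqOn_of_preconnected_of_eventuallyEq (g := fun _ => f z₀) analyticOnNhd_const
      hUconn.isPreconnected hz₀ ?_
    have h₀ := h.self_of_nhds
    filter_upwards [h, hden c d z₀ h0] with x hx hx0
    refine mul_right_cancel₀ (mul_ne_zero hx0 h0) ?_
    linear_combination (c * z₀ + d) * hx - (c * x + d) * h₀ + (x - z₀) * hdet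
  have hglob : ∀ z ∈ U, f z * (c * z + d) = a * z + b :=
    AnalyticOnNhd.eqOn_of_preconnected_of_eventuallyEq
      (f := fun z => f z * (c * z + d)) (g := fun z => a * z + b)
      (han.mul fun z _ => by fun_prop) (fun z _ => by fun_prop) hUconn.isPreconnected hz₀ h
  refine Or.inr ⟨a, b, c, d, hdet, fun z hz => ?_⟩
  have hz0 : c * z + d ≠ 0 := by
    intro hc
    have hnum := hglob z hz
    rw [hc, mul_zero] at hnum
    exact hdet (by linear_combination a * hc + c * hnum)
  exact ⟨hz0, by rw [← hglob z hz, mul_div_cancel_right₀ _ hz0]⟩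
end

section
/- Let α ∈ ℂ with α ≠ 0 and α ≠ 1, let U ⊆ ℂ be a nonempty open connected set, and let f : ℂ → ℂ be continuous on U and satisfy the cross-ratio condition φ(α) on U. Then f also satisfies the cross-ratio condition φ(β) on U for every β in the six-element set P_α = {α, 1/α, 1 − α, 1/(1 − α), α/(α − 1), (α − 1)/α}. -/
/-- Exchanging the first two points inverts the cross ratio. -/
theorem CrossRatioCond.inv {α : ℂ} {U : Set ℂ} {f : ℂ → ℂ} (hα : α ≠ 0)
    (h : CrossRatioCond α U f) : CrossRatioCond α⁻¹ U f := by
  intro z₁ h₁ z₂ h₂ z₃ h₃ z₄ h₄ h₁₂ h₁₃ h₁₄ h₂₃ h₂₄ h₃₄ hz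
  have hα' : α * α⁻¹ = 1 := mul_inv_cancel₀ hα
  have key := h z₂ h₂ z₁ h₁ z₃ h₃ z₄ h₄ h₁₂.symm h₂₃ h₂₄ h₁₃ h₁₄ h₃₄ (by
    linear_combination (-α) * hz - (z₃ - z₂) * (z₄ - z₁) * hα')
  linear_combination (-α⁻¹) * key - (f z₁ - f z₃) * (f z₂ - f z₄) * hα'

/-- Exchanging the middle two points replaces the cross ratio `α` by `1 - α`. -/
theorem CrossRatioCond.one_sub {α : ℂ} {U : Set ℂ} {f : ℂ → ℂ}
    (h : CrossRatioCond α U f) : CrossRatioCond (1 - α) U f := by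
  intro z₁ h₁ z₂ h₂ z₃ h₃ z₄ h₄ h₁₂ h₁₃ h₁₄ h₂₃ h₂₄ h₃₄ hz
  have key := h z₁ h₁ z₃ h₃ z₂ h₂ z₄ h₄ h₁₃ h₁₂ h₁₄ h₂₃.symm h₃₄ h₂₄ (by
    linear_combination hz)
  linear_combination key

theorem crossRatioCond_permuted
    (α : ℂ) (hα0 : α ≠ 0) (hα1 : α ≠ 1)
    (U : Set ℂ) (hUne : U.Nonempty) (hUopen : IsOpen U) (hUconn : IsConnected U)
    (f : ℂ → ℂ) (hf : ContinuousOn f U) (hφ : CrossRatioCond α U f) :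
    ∀ β ∈ ({α, 1 / α, 1 - α, 1 / (1 - α), α / (α - 1), (α - 1) / α} : Set ℂ),
      CrossRatioCond β U f := by
  have h1 : 1 - α ≠ 0 := sub_ne_zero.mpr hα1.symm
  have h2 : α - 1 ≠ 0 := sub_ne_zero.mpr hα1
  rintro β (rfl | rfl | rfl | rfl | rfl | rfl)
  · exact hφ
  · simpa only [one_div] using hφ.inv hα0
  · exact hφ.one_sub
  · simpa only [one_div] using hφ.one_sub.inv h1
  · have e : α / (α - 1) = 1 - (1 - α)⁻¹ := by
      rw [← neg_sub α 1, inv_neg]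
      field_simp
      ring
    exact e ▸ (hφ.one_sub.inv h1).one_sub
  · have e : (α - 1) / α = 1 - α⁻¹ := by field_simp
    exact e ▸ (hφ.inv hα0).one_sub
end

section
/- (Injectivity lemma.) Let α ∈ ℂ with α ≠ 0 and α ≠ 1, let U ⊆ ℂ be a nonempty open connected set, and let f : ℂ → ℂ be continuous on U and satisfy the cross-ratio condition φ(α) on U. Then either f is injective on U, or f is constant on U. -/
lemma Complex.inv_mem_slitPlane_of_mem {z : ℂ} (hz : z ∈ Complex.slitPlane) :
    z⁻¹ ∈ Complex.slitPlane := by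
  have hpos : 0 < Complex.normSq z := Complex.normSq_pos.mpr (Complex.slitPlane_ne_zero hz)
  rw [Complex.mem_slitPlane_iff] at hz ⊢
  rw [Complex.inv_re, Complex.inv_im]
  exact hz.imp (fun h => div_pos h hpos) (fun h => div_ne_zero (neg_ne_zero.mpr h) hpos.ne')

open Filter Topology in
lemma Complex.eventually_norm_mul_sub_one_lt {w : ℝ → ℂ} {w₀ : ℂ}
    (hw : Tendsto w (𝓝[>] 0) (𝓝 w₀)) (h₀ : 0 < w₀.re) :
    ∀ᶠ t : ℝ in 𝓝[>] 0, ‖(t : ℂ) * w t - 1‖ < 1 := by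
  have hid : Tendsto (fun t : ℝ => t) (𝓝[>] 0) (𝓝 0) := tendsto_id.mono_left nhdsWithin_le_nhds
  have h1 : Tendsto (fun t => t * Complex.normSq (w t) - 2 * (w t).re) (𝓝[>] 0)
      (𝓝 (0 * Complex.normSq w₀ - 2 * w₀.re)) :=
    (hid.mul ((Complex.continuous_normSq.tendsto w₀).comp hw)).sub
      (((Complex.continuous_re.tendsto w₀).comp hw).const_mul 2)
  filter_upwards [h1.eventually_lt_const (u := 0) (by linarith), self_mem_nhdsWithin]
    with t ht htpos
  have htpos : 0 < t := htpos
  have key : ‖(t : ℂ) * w t - 1‖ ^ 2 < 1 := by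
    rw [← Complex.normSq_eq_norm_sq, Complex.normSq_apply]
    rw [Complex.normSq_apply] at ht
    simp only [Complex.sub_re, Complex.sub_im, Complex.mul_re, Complex.mul_im, Complex.ofReal_re,
      Complex.ofReal_im, Complex.one_re, Complex.one_im]
    nlinarith [mul_neg_of_pos_of_neg htpos ht]
  exact (sq_lt_one_iff₀ (norm_nonneg _)).mp key

open Filter Topology in
/-- A local map fixing a boundary point `a` of a disc, with multiplier off the closed negative
real axis, maps some point of the disc into the disc. -/
lemma Complex.exists_mem_ball_add_mul_mem_ball {a c : ℂ} (hac : a ≠ c) {g : ℂ → ℂ}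
    (hg : ContinuousAt g a) (hm : g a ∈ Complex.slitPlane) :
    ∃ z ∈ Metric.ball c (dist a c), a + (z - a) * g z ∈ Metric.ball c (dist a c) := by
  set m := g a with hm_def
  set s : ℂ := (‖m‖ : ℂ) + (starRingEnd ℂ) m with hs
  have hm0 : 0 < ‖m‖ := norm_pos_iff.mpr (Complex.slitPlane_ne_zero hm)
  have hre : 0 < ‖m‖ + m.re := by
    rcases hm with h | h
    · linarith
    · have := (Complex.abs_re_lt_norm (z := m)).mpr h
      linarith [neg_abs_le m.re]
  have hs_re : 0 < s.re := by simpa [hs] using hre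
  have hsm_re : 0 < (s * m).re := by
    have h2 : (s * m).re = ‖m‖ * (‖m‖ + m.re) := by
      have : ‖m‖ * ‖m‖ = m.re * m.re + m.im * m.im := by
        rw [← Complex.normSq_apply, Complex.normSq_eq_norm_sq, sq]
      simp [hs, Complex.mul_re]
      linarith
    rw [h2]
    positivity
  have hz : Tendsto (fun t : ℝ => a + (t : ℂ) * (s * (c - a))) (𝓝[>] 0) (𝓝 a) := by
    have : Continuous (fun t : ℝ => a + (t : ℂ) * (s * (c - a))) := by fun_prop
    simpa using (this.tendsto 0).mono_left nhdsWithin_le_nhds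
  have hgz := (hg.tendsto.comp hz).const_mul s
  have e1 := Complex.eventually_norm_mul_sub_one_lt
    (tendsto_const_nhds (x := s) (f := 𝓝[>] (0 : ℝ))) hs_re
  have e2 := Complex.eventually_norm_mul_sub_one_lt hgz hsm_re
  obtain ⟨t, h1, h2⟩ := (e1.and e2).exists
  have hpos : 0 < ‖c - a‖ := norm_pos_iff.mpr (sub_ne_zero.mpr hac.symm)
  have hmem : ∀ q : ℂ, ‖q - 1‖ < 1 → a + q * (c - a) ∈ Metric.ball c (dist a c) := by
    intro q hq
    rw [Metric.mem_ball, dist_eq_norm, dist_comm a c, dist_eq_norm,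
      show a + q * (c - a) - c = (q - 1) * (c - a) by ring, norm_mul]
    exact mul_lt_of_lt_one_left hpos hq
  refine ⟨a + (t : ℂ) * (s * (c - a)), ?_, ?_⟩
  · simpa [mul_assoc] using hmem _ h1
  · convert hmem _ h2 using 1
    simp only [Function.comp]
    ring

/-- A proper nonempty level set of a continuous function on a connected open set is touched
from outside by a disc. -/
lemma exists_ball_touching_fiber {U : Set ℂ} (hUopen : IsOpen U) (hUconn : IsPreconnected U)
    {f : ℂ → ℂ} (hf : ContinuousOn f U) {w : ℂ} (hA : ∃ z ∈ U, f z = w)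
    (hC : ∃ z ∈ U, f z ≠ w) :
    ∃ a c : ℂ, a ∈ U ∧ f a = w ∧ a ≠ c ∧
      ∀ z ∈ Metric.ball c (dist a c), z ∈ U ∧ f z ≠ w := by
  have hopen : IsOpen (U ∩ f ⁻¹' {w}ᶜ) :=
    hf.isOpen_inter_preimage hUopen isOpen_compl_singleton
  obtain ⟨p, ⟨hpcl, hpU⟩, hpC⟩ : ∃ p ∈ closure (U ∩ f ⁻¹' {w}ᶜ) ∩ U, p ∉ U ∩ f ⁻¹' {w}ᶜ := by
    by_contra! h
    obtain ⟨x, hxU, hx⟩ := hC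
    obtain ⟨y, hyU, hy⟩ := hA
    exact (hUconn.subset_of_closure_inter_subset hopen ⟨x, hxU, hxU, hx⟩ h hyU).2 hy
  have hpw : f p = w := by
    by_contra h
    exact hpC ⟨hpU, h⟩
  obtain ⟨ε, hε, hball⟩ := Metric.isOpen_iff.mp hUopen p hpU
  obtain ⟨c, ⟨hcU, hcw⟩, hpc⟩ := Metric.mem_closure_iff.mp hpcl (ε / 2) (half_pos hε)
  have hKU : Metric.closedBall c (dist p c) ⊆ U := by
    intro z hz
    apply hball
    rw [Metric.mem_closedBall] at hz
    rw [Metric.mem_ball]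
    linarith [dist_triangle z c p, dist_comm c p]
  have hcompact : IsCompact (Metric.closedBall c (dist p c) ∩ f ⁻¹' {w}) :=
    (isCompact_closedBall c _).of_isClosed_subset
      ((hf.mono hKU).preimage_isClosed_of_isClosed Metric.isClosed_closedBall isClosed_singleton)
      Set.inter_subset_left
  obtain ⟨a, ⟨haK, haw⟩, hmin⟩ := hcompact.exists_isMinOn
    ⟨p, Metric.mem_closedBall.mpr le_rfl, hpw⟩
    (f := fun z => dist z c) (by fun_prop)
  refine ⟨a, c, hKU haK, haw, fun h => hcw (h ▸ haw), fun z hz => ?_⟩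
  have hzK : z ∈ Metric.closedBall c (dist p c) :=
    Metric.mem_closedBall.mpr ((Metric.mem_ball.mp hz).le.trans haK)
  exact ⟨hKU hzK, fun hzw => (Metric.mem_ball.mp hz).not_ge (hmin ⟨hzK, hzw⟩)⟩

theorem injOn_or_constant_of_crossRatioCond
    (α : ℂ) (hα0 : α ≠ 0) (hα1 : α ≠ 1)
    (U : Set ℂ) (hUne : U.Nonempty) (hUopen : IsOpen U) (hUconn : IsConnected U)
    (f : ℂ → ℂ) (hf : ContinuousOn f U) (hφ : CrossRatioCond α U f) :
    Set.InjOn f U ∨ ∃ w : ℂ, ∀ z ∈ U, f z = w := by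
  by_contra! hcon
  obtain ⟨hinj, hconst⟩ := hcon
  obtain ⟨x, hxU, y, hyU, hxy, hne⟩ : ∃ x ∈ U, ∃ y ∈ U, f x = f y ∧ x ≠ y := by
    simpa [Set.InjOn] using hinj
  obtain ⟨a, c, haU, haw, hac, hball⟩ := exists_ball_touching_fiber hUopen
    hUconn.isPreconnected hf ⟨x, hxU, rfl⟩ (hconst (f x))
  obtain ⟨b, hbU, hbw, hab⟩ : ∃ b ∈ U, f b = f x ∧ a ≠ b := by
    by_cases h : a = x
    · exact ⟨y, hyU, hxy.symm, h ▸ hne⟩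
    · exact ⟨x, hxU, rfl, h⟩
  have hba : b - a ≠ 0 := sub_ne_zero.mpr hab.symm
  have hα1' : 1 - α ≠ 0 := sub_ne_zero.mpr hα1.symm
  have ha_ne : ∀ z ∈ Metric.ball c (dist a c), a ≠ z := fun z hz h => (hball z hz).2 (h ▸ haw)
  have hb_ne : ∀ z ∈ Metric.ball c (dist a c), b ≠ z := fun z hz h => (hball z hz).2 (h ▸ hbw)
  by_cases hslit : α ∈ Complex.slitPlane
  · have hD : (a - a) - α * (a - b) ≠ 0 := by
      rw [show (a - a) - α * (a - b) = α * (b - a) by ring]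
      exact mul_ne_zero hα0 hba
    obtain ⟨z, hz, hz'⟩ := Complex.exists_mem_ball_add_mul_mem_ball hac
      (g := fun z => (b - a) / ((z - a) - α * (z - b)))
      (ContinuousAt.div (by fun_prop) (by fun_prop) hD) (by
        convert Complex.inv_mem_slitPlane_of_mem hslit using 1
        rw [show (a - a) - α * (a - b) = α * (b - a) by ring]
        field_simp)
    set z' := a + (z - a) * ((b - a) / ((z - a) - α * (z - b))) with hz'def
    have hza := sub_ne_zero.mpr (ha_ne z hz).symm
    have hzb := sub_ne_zero.mpr (hb_ne z hz).symm
    have hDz : (z - a) - α * (z - b) ≠ 0 := fun h => ha_ne z' hz' (by simp [hz'def, h])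
    have hrel : (a - z) * (b - z') = α * ((z - b) * (z' - a)) := by
      rw [hz'def]
      field_simp
      ring
    have hzz' : z ≠ z' := by
      intro h
      rw [← h] at hrel
      exact mul_ne_zero (mul_ne_zero hza hzb) hα1' (by linear_combination hrel)
    have himg := hφ a haU b hbU z (hball z hz).1 z' (hball z' hz').1 hab (ha_ne z hz)
      (ha_ne z' hz') (hb_ne z hz) (hb_ne z' hz') hzz' hrel
    rw [haw, hbw] at himg
    exact mul_ne_zero (mul_ne_zero (sub_ne_zero.mpr (hball z hz).2)
      (sub_ne_zero.mpr (hball z' hz').2)) hα1' (by linear_combination himg)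
  · have hslit' : 1 - α ∈ Complex.slitPlane := by
      rw [Complex.mem_slitPlane_iff] at hslit ⊢
      push Not at hslit
      left
      rw [Complex.sub_re, Complex.one_re]
      linarith [hslit.1]
    have hD : α * (b - a) + (a - b) ≠ 0 := by
      rw [show α * (b - a) + (a - b) = -((1 - α) * (b - a)) by ring]
      exact neg_ne_zero.mpr (mul_ne_zero hα1' hba)
    obtain ⟨z, hz, hz'⟩ := Complex.exists_mem_ball_add_mul_mem_ball hac
      (g := fun z => (a - b) / (α * (b - z) + (a - b)))
      (ContinuousAt.div (by fun_prop) (by fun_prop) hD) (by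
        convert Complex.inv_mem_slitPlane_of_mem hslit' using 1
        rw [show α * (b - a) + (a - b) = -((1 - α) * (b - a)) by ring,
          show a - b = -(b - a) by ring, neg_div_neg_eq]
        field_simp)
    set z' := a + (z - a) * ((a - b) / (α * (b - z) + (a - b))) with hz'def
    have hza := sub_ne_zero.mpr (ha_ne z hz).symm
    have hbz := sub_ne_zero.mpr (hb_ne z hz)
    have hDz : α * (b - z) + (a - b) ≠ 0 := fun h => ha_ne z' hz' (by simp [hz'def, h])
    have hrel : (a - b) * (z - z') = α * ((b - z) * (z' - a)) := by
      rw [hz'def]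
      field_simp
      ring
    have hzz' : z ≠ z' := by
      intro h
      rw [← h] at hrel
      exact mul_ne_zero (mul_ne_zero hbz hza) hα0 (by linear_combination -hrel)
    have himg := hφ a haU z (hball z hz).1 b hbU z' (hball z' hz').1 (ha_ne z hz) hab
      (ha_ne z' hz') (hb_ne z hz).symm hzz' (hb_ne z' hz') hrel
    rw [haw, hbw] at himg
    exact mul_ne_zero (mul_ne_zero (sub_ne_zero.mpr (hball z hz).2)
      (sub_ne_zero.mpr (hball z' hz').2)) hα0 (by linear_combination himg)
end

section
/- Let α ∈ ℂ with α ≠ 0 and α ≠ 1, let U ⊆ ℂ be open, and let f : ℂ → ℂ be continuous on U, injective on U, and satisfy the affine cross-ratio condition ψ(α) on U. Then f is affine on every line segment contained in U: for all a, b ∈ ℂ such that the segment [a, b] = {(1 − t)·a + t·b : t ∈ [0, 1]} is contained in U, and for every t ∈ [0, 1], one has f ((1 − t)·a + t·b) = (1 − t)·(f a) + t·(f b). In particular, f maps any line segment contained in U onto the line segment between the images of its endpoints. -/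
/-- `f` satisfies the affine cross-ratio condition ψ(α) on `U`: for all pairwise
distinct `a, b, c ∈ U` with `a - c = -α * (c - b)` (i.e. the cross ratio
`[a : b : c : ∞] = α`), one has `f a - f c = -α * (f c - f b)`. -/
def AffineCrossRatioCond (α : ℂ) (U : Set ℂ) (f : ℂ → ℂ) : Prop :=
  ∀ a ∈ U, ∀ b ∈ U, ∀ c ∈ U,
    a ≠ b → a ≠ c → b ≠ c →
    a - c = -α * (c - b) → f a - f c = -α * (f c - f b)

open Filter Topology Set

/-- The affine cross-ratio condition as a functional equation, degenerate triples included. -/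
lemma AffineCrossRatioCond.map_combo {α : ℂ} (hα0 : α ≠ 0) (hα1 : α ≠ 1) {U : Set ℂ}
    {f : ℂ → ℂ} (h : AffineCrossRatioCond α U f) {x y z : ℂ} (hx : x ∈ U) (hy : y ∈ U)
    (hz : z ∈ U) (hxyz : z = (1 - α) * x + α * y) :
    f z = (1 - α) * f x + α * f y := by
  by_cases hxy : y = x
  · have hzx : z = x := by rw [hxyz, hxy]; ring
    rw [hzx, hxy]; ring
  · have hzy : z ≠ y := by
      intro e
      have : (1 - α) * (y - x) = 0 := by linear_combination hxyz - e
      rcases mul_eq_zero.1 this with h1 | h1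
      · exact hα1 (sub_eq_zero.1 h1).symm
      · exact hxy (sub_eq_zero.1 h1)
    have hzx : z ≠ x := by
      intro e
      have : α * (y - x) = 0 := by linear_combination e - hxyz
      rcases mul_eq_zero.1 this with h1 | h1
      · exact hα0 h1
      · exact hxy (sub_eq_zero.1 h1)
    have := h z hz y hy x hx hzy hzx hxy (by rw [hxyz]; ring)
    linear_combination this

/-- Every point of `U` is a center of odd symmetry for `f`, locally. -/
lemma AffineCrossRatioCond.eventually_add_eq {α : ℂ} (hα0 : α ≠ 0) (hα1 : α ≠ 1) {U : Set ℂ}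
    (hU : IsOpen U) {f : ℂ → ℂ} (h : AffineCrossRatioCond α U f) {p : ℂ} (hp : p ∈ U) :
    ∀ᶠ w in 𝓝 (0 : ℂ), f (p + w) + f (p - w) = 2 * f p := by
  have hmem : ∀ c : ℂ, ∀ᶠ w in 𝓝 (0 : ℂ), p + c * w ∈ U := fun c =>
    ContinuousAt.eventually_mem (f := fun w : ℂ => p + c * w) (by fun_prop)
      (hU.mem_nhds (by simpa using hp))
  have hβ : 1 - α ≠ 0 := sub_ne_zero.2 hα1.symm
  filter_upwards [hmem 1, hmem (-1), hmem (1 - α)⁻¹, hmem (-α⁻¹)] with w h1 h2 h3 h4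
  have e1 := h.map_combo hα0 hα1 h3 hp h1 (by field_simp; ring)
  have e2 := h.map_combo hα0 hα1 hp h4 h2 (by field_simp; ring)
  have e3 := h.map_combo hα0 hα1 h3 h4 hp (by field_simp; ring)
  rw [one_mul] at e1
  rw [neg_one_mul, ← sub_eq_add_neg] at e2
  linear_combination e1 + e2 - e3

/-- A continuous function on `[0, 1]` which vanishes at the endpoints and locally satisfies the
midpoint identity is zero. -/
lemma eq_zero_of_eventually_midpoint {E : Type*} [NormedAddCommGroup E] [NormedSpace ℝ E]
    {φ : ℝ → E}
    (hφ : ContinuousOn φ (Icc 0 1)) (h0 : φ 0 = 0) (h1 : φ 1 = 0)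
    (hmid : ∀ t ∈ Ioo (0 : ℝ) 1, ∀ᶠ u in 𝓝 (0 : ℝ), φ (t + u) + φ (t - u) = (2 : ℝ) • φ t)
    {t : ℝ} (ht : t ∈ Icc (0 : ℝ) 1) : φ t = 0 := by
  obtain ⟨m, hm, hmax⟩ := isCompact_Icc.exists_isMaxOn ⟨t, ht⟩ hφ.norm
  have hK : IsCompact (Icc (0 : ℝ) 1 ∩ (fun s => ‖φ s‖) ⁻¹' {‖φ m‖}) :=
    isCompact_Icc.of_isClosed_subset
      (hφ.norm.preimage_isClosed_of_isClosed isClosed_Icc isClosed_singleton) inter_subset_left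
  obtain ⟨s, ⟨hs, hsm⟩, hleast⟩ := hK.exists_isLeast ⟨m, hm, rfl⟩
  replace hsm : ‖φ s‖ = ‖φ m‖ := hsm
  suffices hz : φ s = 0 by
    have hle : ‖φ t‖ ≤ ‖φ m‖ := hmax ht
    rw [← hsm, hz, norm_zero] at hle
    exact norm_le_zero_iff.1 hle
  rcases hs.1.eq_or_lt with rfl | hs0
  · exact h0
  rcases hs.2.eq_or_lt with rfl | hs1
  · exact h1
  exfalso
  have hev := (hmid s ⟨hs0, hs1⟩).filter_mono (nhdsWithin_le_nhds (s := Ioi 0))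
  obtain ⟨u, hu, hu0, hu1⟩ := (hev.and
    (Ioo_mem_nhdsGT (lt_min hs0 (sub_pos.2 hs1)))).exists
  have hus := hu1.trans_le (min_le_left _ _)
  have hus' := hu1.trans_le (min_le_right _ _)
  have hl : s - u ∈ Icc (0 : ℝ) 1 := ⟨by linarith, by linarith⟩
  have hr : ‖φ (s + u)‖ ≤ ‖φ m‖ := hmax (show s + u ∈ Icc (0 : ℝ) 1 from ⟨by linarith, by linarith⟩)
  have hl' : ‖φ (s - u)‖ ≤ ‖φ m‖ := hmax hl
  have htri := norm_add_le (φ (s + u)) (φ (s - u))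
  rw [hu, norm_smul, Real.norm_ofNat] at htri
  have : s ≤ s - u := hleast ⟨hl, le_antisymm hl' (by linarith)⟩
  linarith

theorem affine_on_segments_of_affineCrossRatioCond
    (α : ℂ) (hα0 : α ≠ 0) (hα1 : α ≠ 1)
    (U : Set ℂ) (hUopen : IsOpen U)
    (f : ℂ → ℂ) (hf : ContinuousOn f U) (hinj : Set.InjOn f U)
    (hψ : AffineCrossRatioCond α U f) :
    ∀ a b : ℂ, segment ℝ a b ⊆ U →
      ∀ t ∈ Set.Icc (0 : ℝ) 1,
        f ((1 - (t : ℂ)) * a + (t : ℂ) * b)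
          = (1 - (t : ℂ)) * f a + (t : ℂ) * f b := by
  intro a b hab t ht
  have hseg : ∀ s ∈ Icc (0 : ℝ) 1, (1 - (s : ℂ)) * a + (s : ℂ) * b ∈ U := fun s hs =>
    hab ⟨1 - s, s, by linarith [hs.2], hs.1, by ring, by simp [Complex.real_smul]⟩
  have key := eq_zero_of_eventually_midpoint
    (φ := fun s : ℝ => f ((1 - (s : ℂ)) * a + (s : ℂ) * b)
      - ((1 - (s : ℂ)) * f a + (s : ℂ) * f b))
    ((hf.comp (by fun_prop) hseg).sub (by fun_prop)) (by simp) (by simp) ?_ ht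
  · exact sub_eq_zero.1 key
  · intro s hs
    have hT : Tendsto (fun u : ℝ => (u : ℂ) * (b - a)) (𝓝 0) (𝓝 0) :=
      Continuous.tendsto' (by fun_prop) _ _ (by simp)
    filter_upwards [hT.eventually (hψ.eventually_add_eq hα0 hα1 hUopen
      (hseg s (Ioo_subset_Icc_self hs)))] with u hu
    have e1 : (1 - ((s + u : ℝ) : ℂ)) * a + ((s + u : ℝ) : ℂ) * b
        = (1 - (s : ℂ)) * a + (s : ℂ) * b + (u : ℂ) * (b - a) := by push_cast; ring
    have e2 : (1 - ((s - u : ℝ) : ℂ)) * a + ((s - u : ℝ) : ℂ) * b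
        = (1 - (s : ℂ)) * a + (s : ℂ) * b - (u : ℂ) * (b - a) := by push_cast; ring
    simp only [e1, e2]
    rw [Complex.real_smul]
    push_cast
    linear_combination hu
end

section
/- Let α ∈ ℂ with α ≠ 0 and α ≠ 1, let U ⊆ ℂ be open, and let f : ℂ → ℂ be continuous on U, injective on U, and satisfy the affine cross-ratio condition ψ(α) on U. If a straight line L = {p + t·v : t ∈ ℝ} (with p, v ∈ ℂ, v ≠ 0) is entirely contained in U, then f is affine on L: for every t ∈ ℝ, f (p + t·v) = f p + t·(f (p + v) − f p). In particular, f maps any straight line contained in U into a straight line, and any ray contained in U into a ray. -/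
open Filter Topology in
/-- A continuous function on a compact interval that satisfies the midpoint identity near each
interior point and vanishes at the endpoints is identically zero. -/
theorem eq_zero_on_Icc_of_local_midpoint {E : Type*} [NormedAddCommGroup E] [NormedSpace ℝ E]
    {k : ℝ → E} {a b : ℝ} (hk : ContinuousOn k (Set.Icc a b))
    (hmid : ∀ x ∈ Set.Ioo a b, ∀ᶠ s in 𝓝 (0 : ℝ), k (x + s) + k (x - s) = (2 : ℝ) • k x)
    (ha : k a = 0) (hb : k b = 0) : ∀ x ∈ Set.Icc a b, k x = 0 := by
  intro x hx
  obtain ⟨m, hm, hmax⟩ := isCompact_Icc.exists_isMaxOn ⟨x, hx⟩ hk.norm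
  have hclosed : IsClosed (Set.Icc a b ∩ (fun y => ‖k y‖) ⁻¹' {‖k m‖}) :=
    hk.norm.preimage_isClosed_of_isClosed isClosed_Icc isClosed_singleton
  obtain ⟨y, ⟨hy, hym⟩, hleast⟩ :=
    (isCompact_Icc.of_isClosed_subset hclosed Set.inter_subset_left).exists_isLeast ⟨m, hm, rfl⟩
  have hym : ‖k y‖ = ‖k m‖ := hym
  have hle : ∀ z ∈ Set.Icc a b, ‖k z‖ ≤ ‖k y‖ := fun z hz => hym ▸ hmax hz
  suffices hy0 : k y = 0 by
    simpa [hy0] using hle x hx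
  rcases hy.1.eq_or_lt with h | hay
  · rw [← h, ha]
  rcases hy.2.eq_or_lt with h | hyb
  · rw [h, hb]
  exfalso
  have hsmall : ∀ᶠ s in 𝓝[>] (0 : ℝ), s < min (y - a) (b - y) :=
    nhdsWithin_le_nhds (eventually_lt_nhds (lt_min (sub_pos.2 hay) (sub_pos.2 hyb)))
  obtain ⟨s, hs, hs_lt, hs0⟩ := (((hmid y ⟨hay, hyb⟩).filter_mono nhdsWithin_le_nhds).and
    (hsmall.and (self_mem_nhdsWithin (s := Set.Ioi 0)))).exists
  have hs0 : 0 < s := hs0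
  obtain ⟨hsa, hsb⟩ := lt_min_iff.1 hs_lt
  have hplus := hle (y + s) ⟨by linarith, by linarith⟩
  have hmem : y - s ∈ Set.Icc a b := ⟨by linarith, by linarith⟩
  have hminus : ‖k (y - s)‖ < ‖k y‖ := by
    refine (hle _ hmem).lt_of_ne fun h => ?_
    have := hleast ⟨hmem, h.trans hym⟩
    linarith
  have htri := norm_add_le (k (y + s)) (k (y - s))
  rw [hs, norm_smul, Real.norm_two] at htri
  linarith

open Filter Topology in
/-- A continuous function on `ℝ` that satisfies the midpoint identity near each point is affine. -/
theorem eq_affine_of_local_midpoint {E : Type*} [NormedAddCommGroup E] [NormedSpace ℝ E]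
    {h : ℝ → E} (hh : Continuous h)
    (hmid : ∀ x, ∀ᶠ s in 𝓝 (0 : ℝ), h (x + s) + h (x - s) = (2 : ℝ) • h x) (t : ℝ) :
    h t = h 0 + t • (h 1 - h 0) := by
  set R : ℝ := |t| + 1 with hR
  have hRpos : 0 < R := by positivity
  set D : E := (2 * R)⁻¹ • (h R - h (-R)) with hD
  set C : E := (2 : ℝ)⁻¹ • (h R + h (-R)) with hC
  have key : ∀ x ∈ Set.Icc (-R) R, h x - (C + x • D) = 0 := by
    refine eq_zero_on_Icc_of_local_midpoint (by fun_prop) (fun x _ => ?_) ?_ ?_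
    · filter_upwards [hmid x] with s hs
      have : h (x + s) = (2 : ℝ) • h x - h (x - s) := eq_sub_of_add_eq hs
      rw [this]
      module
    all_goals
      rw [hC, hD]
      match_scalars <;> field_simp <;> ring
  have hx : ∀ x ∈ Set.Icc (-R) R, h x = C + x • D := fun x hx => sub_eq_zero.1 (key x hx)
  have habs := abs_nonneg t
  rw [hx t ⟨by linarith [neg_abs_le t], by linarith [le_abs_self t]⟩,
    hx 0 ⟨by linarith, by linarith⟩, hx 1 ⟨by linarith, by linarith⟩]
  module

/-- The affine cross-ratio condition says that `f` preserves the affine combination with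
weights `1 - α` and `α`. -/
theorem AffineCrossRatioCond.map_combination {α : ℂ} {U : Set ℂ} {f : ℂ → ℂ}
    (hψ : AffineCrossRatioCond α U f) (hα0 : α ≠ 0) (hα1 : α ≠ 1) {a b c : ℂ}
    (ha : a ∈ U) (hb : b ∈ U) (hc : c ∈ U) (h : a = (1 - α) * c + α * b) :
    f a = (1 - α) * f c + α * f b := by
  rcases eq_or_ne b c with rfl | hbc
  · rw [show a = b by rw [h]; ring]
    ring
  have hab : a ≠ b := fun hab =>
    mul_ne_zero (sub_ne_zero.2 hα1.symm) (sub_ne_zero.2 hbc.symm) (by linear_combination hab - h)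
  have hac : a ≠ c := fun hac =>
    mul_ne_zero hα0 (sub_ne_zero.2 hbc) (by linear_combination hac - h)
  linear_combination hψ a ha b hb c hc hab hac hbc (by linear_combination h)

open Filter Topology in
/-- A function satisfying the affine cross-ratio condition on an open set satisfies the midpoint
identity near each point of that set. -/
theorem AffineCrossRatioCond.eventually_midpoint {α : ℂ} {U : Set ℂ} {f : ℂ → ℂ}
    (hψ : AffineCrossRatioCond α U f) (hα0 : α ≠ 0) (hα1 : α ≠ 1) (hU : IsOpen U)
    {x : ℂ} (hx : x ∈ U) : ∀ᶠ y in 𝓝 (0 : ℂ), f (x + y) + f (x - y) = 2 * f x := by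
  have hβ : 1 - α ≠ 0 := sub_ne_zero.2 hα1.symm
  have near : ∀ r : ℂ, ∀ᶠ y in 𝓝 (0 : ℂ), x + r * y ∈ U := fun r => by
    have hc : ContinuousAt (fun y : ℂ => x + r * y) 0 := by fun_prop
    exact hc.eventually_mem (hU.mem_nhds (by simpa using hx))
  filter_upwards [near 1, near (-1), near (1 - α)⁻¹, near (-α⁻¹)] with y h₁ h₂ h₃ h₄
  have e₁ := hψ.map_combination hα0 hα1 h₁ hx h₃ (by field_simp; ring)
  have e₂ := hψ.map_combination hα0 hα1 h₂ h₄ hx (by field_simp; ring)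
  have e₃ := hψ.map_combination hα0 hα1 hx h₄ h₃ (by field_simp; ring)
  rw [show x + y = x + 1 * y by ring, show x - y = x + -1 * y by ring]
  linear_combination e₁ + e₂ - e₃

theorem affine_on_lines_of_affineCrossRatioCond
    (α : ℂ) (hα0 : α ≠ 0) (hα1 : α ≠ 1)
    (U : Set ℂ) (hUopen : IsOpen U)
    (f : ℂ → ℂ) (hf : ContinuousOn f U) (hinj : Set.InjOn f U)
    (hψ : AffineCrossRatioCond α U f) :
    ∀ p v : ℂ, v ≠ 0 → (∀ t : ℝ, p + (t : ℂ) * v ∈ U) →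
      ∀ t : ℝ, f (p + (t : ℂ) * v) = f p + (t : ℂ) * (f (p + v) - f p) := by
  intro p v _ hL t
  have hcont : Continuous fun t : ℝ => f (p + (t : ℂ) * v) :=
    hf.comp_continuous (by fun_prop) hL
  have haff := eq_affine_of_local_midpoint hcont (fun x => ?_) t
  · simpa using haff
  · have htend : Filter.Tendsto (fun s : ℝ => (s : ℂ) * v) (nhds 0) (nhds 0) :=
      Continuous.tendsto' (by fun_prop) _ _ (by simp)
    filter_upwards [htend.eventually (hψ.eventually_midpoint hα0 hα1 hUopen (hL x))] with s hs
    rw [Complex.real_smul]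
    convert hs using 3 <;> push_cast <;> ring_nf
end

section
/- (Kobayashi's theorem.) Let λ ∈ ℂ \ ℝ and let U ⊆ ℂ be a nonempty open connected set. Suppose f : ℂ → ℂ is injective on U and real-differentiable at every point of U (differentiable over ℝ, viewing ℂ as a real vector space), and that for all pairwise distinct points z₁, z₂, z₃, z₄ ∈ U with (z₁ − z₃)·(z₂ − z₄) = λ·(z₃ − z₂)·(z₄ − z₁), one has (f z₁ − f z₃)·(f z₂ − f z₄) = λ·(f z₃ − f z₂)·(f z₄ − f z₁). Then there exist a, b, c, d ∈ ℂ with a·d − b·c ≠ 0 such that for all z ∈ U, c·z + d ≠ 0 and f z = (a·z + b)/(c·z + d). -/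
section

open Filter Topology

/-- A map preserving the cross ratio `lam` satisfies the corresponding relation on the quadruples
`p + (lam + 1) * h`, `p - (lam + 1) * h`, `p`, `p + (lam - 1) * h` for all small `h ≠ 0`. -/
theorem eventually_relation {lam : ℂ} (hlam : lam ∉ Set.range ((↑) : ℝ → ℂ))
    {U : Set ℂ} (hU : IsOpen U) {f : ℂ → ℂ}
    (hφ : ∀ z₁ ∈ U, ∀ z₂ ∈ U, ∀ z₃ ∈ U, ∀ z₄ ∈ U,
      z₁ ≠ z₂ → z₁ ≠ z₃ → z₁ ≠ z₄ → z₂ ≠ z₃ → z₂ ≠ z₄ → z₃ ≠ z₄ →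
      (z₁ - z₃) * (z₂ - z₄) = lam * ((z₃ - z₂) * (z₄ - z₁)) →
      (f z₁ - f z₃) * (f z₂ - f z₄) = lam * ((f z₃ - f z₂) * (f z₄ - f z₁)))
    {p : ℂ} (hp : p ∈ U) :
    ∀ᶠ h in 𝓝[≠] (0 : ℂ),
      (f (p + (lam + 1) * h) - f p) * (f (p + -(lam + 1) * h) - f (p + (lam - 1) * h)) =
      lam * ((f p - f (p + -(lam + 1) * h)) *
        (f (p + (lam - 1) * h) - f (p + (lam + 1) * h))) := by
  have h0 : lam ≠ 0 := fun h => hlam ⟨0, by simp [h]⟩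
  have h1 : lam - 1 ≠ 0 := fun h => hlam ⟨1, by simp [sub_eq_zero.1 h]⟩
  have h2 : lam + 1 ≠ 0 := fun h => hlam ⟨-1, by simp [eq_neg_of_add_eq_zero_left h]⟩
  have near (w : ℂ) : ∀ᶠ h in 𝓝[≠] (0 : ℂ), p + w * h ∈ U := by
    have hc : ContinuousAt (fun h : ℂ => p + w * h) 0 := by fun_prop
    exact (hc.eventually (by simpa using hU.mem_nhds hp)).filter_mono nhdsWithin_le_nhds
  filter_upwards [near (lam + 1), near (-(lam + 1)), near (lam - 1), self_mem_nhdsWithin]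
    with h hz₁ hz₂ hz₄ (hh : h ≠ 0)
  refine hφ _ hz₁ _ hz₂ _ hp _ hz₄ ?_ ?_ ?_ ?_ ?_ ?_ (by ring)
  · exact fun e => mul_ne_zero (mul_ne_zero two_ne_zero h2) hh (by linear_combination e)
  · exact fun e => mul_ne_zero h2 hh (by linear_combination e)
  · exact fun e => mul_ne_zero two_ne_zero hh (by linear_combination e)
  · exact fun e => mul_ne_zero h2 hh (by linear_combination -e)
  · exact fun e => mul_ne_zero (mul_ne_zero two_ne_zero h0) hh (by linear_combination -e)
  · exact fun e => mul_ne_zero h1 hh (by linear_combination -e)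

/-- Infinitesimal preservation of a non-real cross ratio forces the Cauchy-Riemann equation. -/
theorem differentiableAt_complex_of_relation {lam : ℂ} (hlam : lam ∉ Set.range ((↑) : ℝ → ℂ))
    {f : ℂ → ℂ} {p : ℂ} (hf : DifferentiableAt ℝ f p)
    (h : ∀ᶠ h in 𝓝[≠] (0 : ℂ),
      (f (p + (lam + 1) * h) - f p) * (f (p + -(lam + 1) * h) - f (p + (lam - 1) * h)) =
      lam * ((f p - f (p + -(lam + 1) * h)) *
        (f (p + (lam - 1) * h) - f (p + (lam + 1) * h)))) :
    DifferentiableAt ℂ f p := by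
  refine differentiableAt_complex_iff_differentiableAt_real.2 ⟨hf, ?_⟩
  set L := fderiv ℝ f p
  have h2 : lam + 1 ≠ 0 := fun h => hlam ⟨-1, by simp [eq_neg_of_add_eq_zero_left h]⟩
  have him : lam.im ≠ 0 := fun h => hlam ⟨lam.re, Complex.ext rfl (by simp [h])⟩
  have hL (z : ℂ) : L z = z.re * L 1 + z.im * L Complex.I := by
    conv_lhs => rw [show z = z.re • (1 : ℂ) + z.im • Complex.I by simp]
    rw [map_add, map_smul, map_smul, Complex.real_smul, Complex.real_smul]
  have lim (w : ℂ) : Tendsto (fun t : ℝ => (t : ℂ)⁻¹ * (f (p + w * t) - f p)) (𝓝[≠] 0)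
      (𝓝 (L w)) := by
    refine (hf.hasFDerivAt.hasLineDerivAt w).tendsto_slope_zero.congr fun t => ?_
    simp [mul_comm]
  have key (s : ℂ) (hs : s ≠ 0) : L ((lam + 1) * s) * (L (lam * s) - lam * L s) = 0 := by
    have hev : ∀ᶠ t : ℝ in 𝓝[≠] 0,
        (f (p + ((lam + 1) * s) * t) - f p) *
          (f (p + (-(lam + 1) * s) * t) - f (p + ((lam - 1) * s) * t)) =
        lam * ((f p - f (p + (-(lam + 1) * s) * t)) *
          (f (p + ((lam - 1) * s) * t) - f (p + ((lam + 1) * s) * t))) := by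
      have ht : Tendsto (fun t : ℝ => s * (t : ℂ)) (𝓝[≠] 0) (𝓝[≠] 0) := by
        refine tendsto_nhdsWithin_iff.2 ⟨?_, ?_⟩
        · have : ContinuousAt (fun t : ℝ => s * (t : ℂ)) 0 := by fun_prop
          simpa [ContinuousAt] using this.tendsto.mono_left nhdsWithin_le_nhds
        · filter_upwards [self_mem_nhdsWithin] with t ht
          simpa [hs] using ht
      filter_upwards [ht.eventually h] with t ht
      simpa only [mul_assoc] using ht
    have e := tendsto_nhds_unique_of_eventuallyEq
      ((lim ((lam + 1) * s)).mul ((lim (-(lam + 1) * s)).sub (lim ((lam - 1) * s))))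
      (((lim (-(lam + 1) * s)).neg.mul
        ((lim ((lam - 1) * s)).sub (lim ((lam + 1) * s)))).const_mul lam)
      (hev.mono fun t ht => by linear_combination (t : ℂ)⁻¹ ^ 2 * ht)
    rw [show -(lam + 1) * s = -(lam * s + s) by ring, show (lam + 1) * s = lam * s + s by ring,
      show (lam - 1) * s = lam * s - s by ring] at e
    rw [show (lam + 1) * s = lam * s + s by ring]
    simp only [map_add, map_sub, map_neg] at e ⊢
    linear_combination -e / 2
  have conf (v : ℂ) (hv : v ≠ 0) (hLv : L v ≠ 0) : L Complex.I = Complex.I • L 1 := by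
    have hs : v / (lam + 1) ≠ 0 := div_ne_zero hv h2
    have e := key _ hs
    rw [mul_div_cancel₀ _ h2] at e
    replace e := (mul_eq_zero.1 e).resolve_left hLv
    set s := v / (lam + 1)
    have e' : (lam.im : ℂ) * (starRingEnd ℂ s) * (L Complex.I - Complex.I * L 1) = 0 := by
      rw [hL (lam * s), hL s] at e
      have hl := Complex.re_add_im lam
      have hc : starRingEnd ℂ s = s.re - s.im * Complex.I := by
        apply Complex.ext <;> simp
      simp only [Complex.mul_re, Complex.mul_im] at e
      push_cast at e
      rw [hc]
      linear_combination e - (s.re * L 1 + s.im * L Complex.I) * hl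
        + lam.im * s.im * L 1 * Complex.I_sq
    have hne : (lam.im : ℂ) * (starRingEnd ℂ s) ≠ 0 :=
      mul_ne_zero (by exact_mod_cast him) (by simpa using hs)
    exact sub_eq_zero.1 ((mul_eq_zero.1 e').resolve_left hne)
  by_cases h1 : L 1 = 0
  · by_cases hI : L Complex.I = 0
    · simp [h1, hI]
    · exact conf _ Complex.I_ne_zero hI
  · exact conf _ one_ne_zero h1

/-- Third order Taylor expansion of an analytic function with continuous remainder factor. -/
theorem AnalyticAt.exists_cubic_taylor {f : ℂ → ℂ} {p : ℂ} (hf : AnalyticAt ℂ f p) :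
    ∃ r : ℂ → ℂ, ContinuousAt r p ∧ ∀ z, f z = f p + deriv f p * (z - p)
      + deriv (deriv f) p / 2 * (z - p) ^ 2 + deriv (deriv (deriv f)) p / 6 * (z - p) ^ 3
      + (z - p) ^ 4 * r z := by
  have hs := hf.hasFPowerSeriesAt
  have hval (n : ℕ) : (Function.swap dslope p)^[n] f p = iteratedDeriv n f p / n.factorial := by
    have := (hs.has_fpower_series_iterate_dslope_fslope n).coeff_zero 1
    rw [← this]
    have h3 := FormalMultilinearSeries.coeff_iterate_fslope (p :=
      FormalMultilinearSeries.ofScalars ℂ fun n ↦ iteratedDeriv n f p / n.factorial) n 0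
    simp only [FormalMultilinearSeries.coeff] at h3
    convert h3 using 1
    simp
  have hstep (n : ℕ) (z : ℂ) : (Function.swap dslope p)^[n] f z
      = iteratedDeriv n f p / n.factorial + (z - p) * (Function.swap dslope p)^[n + 1] f z := by
    rw [← hval, Function.iterate_succ_apply']
    have := sub_smul_dslope ((Function.swap dslope p)^[n] f) p z
    simp only [smul_eq_mul] at this
    simp only [Function.swap, this]
    ring
  refine ⟨(Function.swap dslope p)^[4] f,
    (hs.has_fpower_series_iterate_dslope_fslope 4).analyticAt.continuousAt, fun z => ?_⟩
  have e0 := hstep 0 z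
  have e1 := hstep 1 z
  have e2 := hstep 2 z
  have e3 := hstep 3 z
  simp only [iteratedDeriv_succ, iteratedDeriv_zero, Function.iterate_succ_apply', Function.iterate_zero, id,
    Nat.factorial] at e0 e1 e2 e3
  norm_num at e0 e1 e2 e3
  simp only [Function.iterate_succ_apply', Function.iterate_zero, id]
  linear_combination e0 + (z - p) * e1 + (z - p) ^ 2 * e2 + (z - p) ^ 3 * e3

/-- An analytic map preserving the cross ratio `lam` near `p` has vanishing Schwarzian at `p`. -/
theorem schwarzian_eq_zero_of_relation {lam : ℂ} (hlam : lam ∉ Set.range ((↑) : ℝ → ℂ))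
    {f : ℂ → ℂ} {p : ℂ} (hf : AnalyticAt ℂ f p)
    (h : ∀ᶠ h in 𝓝[≠] (0 : ℂ),
      (f (p + (lam + 1) * h) - f p) * (f (p + -(lam + 1) * h) - f (p + (lam - 1) * h)) =
      lam * ((f p - f (p + -(lam + 1) * h)) *
        (f (p + (lam - 1) * h) - f (p + (lam + 1) * h)))) :
    2 * deriv f p * deriv (deriv (deriv f)) p = 3 * deriv (deriv f) p ^ 2 := by
  have h0 : lam ≠ 0 := fun h => hlam ⟨0, by simp [h]⟩
  have h1 : lam - 1 ≠ 0 := fun h => hlam ⟨1, by simp [sub_eq_zero.1 h]⟩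
  have h2 : lam + 1 ≠ 0 := fun h => hlam ⟨-1, by simp [eq_neg_of_add_eq_zero_left h]⟩
  obtain ⟨r, hr, hT⟩ := hf.exists_cubic_taylor
  generalize hc₁ : deriv f p = c₁ at *
  generalize hc₂ : deriv (deriv f) p / 2 = c₂ at *
  generalize hc₃ : deriv (deriv (deriv f)) p / 6 = c₃ at *
  let w₁ := lam + 1
  let w₂ := -(lam + 1)
  let w₄ := lam - 1
  let x (w h : ℂ) := c₁ * w + c₂ * w ^ 2 * h + c₃ * w ^ 3 * h ^ 2
  let e (w h : ℂ) := w ^ 4 * r (p + w * h)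
  have hF (w h : ℂ) : f (p + w * h) - f p = h * (x w h + h ^ 3 * e w h) := by
    rw [hT (p + w * h)]
    simp only [x, e]
    ring
  let R (h : ℂ) : ℂ :=
    c₂ * c₃ * (w₁ ^ 2 * (w₂ ^ 3 - w₄ ^ 3) + w₁ ^ 3 * (w₂ ^ 2 - w₄ ^ 2)
      + lam * (w₂ ^ 2 * (w₄ ^ 3 - w₁ ^ 3) + w₂ ^ 3 * (w₄ ^ 2 - w₁ ^ 2)))
    + h * (c₃ ^ 2 * (w₁ ^ 3 * (w₂ ^ 3 - w₄ ^ 3) + lam * (w₂ ^ 3 * (w₄ ^ 3 - w₁ ^ 3))))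
    + (e w₁ h * (x w₂ h - x w₄ h) + x w₁ h * (e w₂ h - e w₄ h)
      + h ^ 3 * (e w₁ h * (e w₂ h - e w₄ h)))
    + lam * (e w₂ h * (x w₄ h - x w₁ h) + x w₂ h * (e w₄ h - e w₁ h)
      + h ^ 3 * (e w₂ h * (e w₄ h - e w₁ h)))
  have hR : ContinuousAt R 0 := by
    have he (w : ℂ) : ContinuousAt (e w) 0 := by
      have : ContinuousAt (fun h => r (p + w * h)) 0 :=
        ContinuousAt.comp (g := r) (f := fun h : ℂ => p + w * h) (by simpa using hr) (by fun_prop)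
      exact continuousAt_const.mul this
    have hx (w : ℂ) : ContinuousAt (x w) 0 := by
      simp only [x]; fun_prop
    have := he w₁
    have := he w₂
    have := he w₄
    have := hx w₁
    have := hx w₂
    have := hx w₄
    simp only [R]
    fun_prop
  have hz : ∀ᶠ h in 𝓝[≠] (0 : ℂ),
      4 * lam * (lam + 1) ^ 2 * (lam - 1) * (c₁ * c₃ - c₂ ^ 2) + h * R h = 0 := by
    filter_upwards [h, self_mem_nhdsWithin] with h hh (hne : h ≠ 0)
    have E₁ := hF w₁ h
    have E₂ := hF w₂ h
    have E₄ := hF w₄ h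
    have hG : (f (p + w₁ * h) - f p) * ((f (p + w₂ * h) - f p) - (f (p + w₄ * h) - f p))
        + lam * ((f (p + w₂ * h) - f p) * ((f (p + w₄ * h) - f p) - (f (p + w₁ * h) - f p)))
        = 0 := by
      linear_combination hh
    rw [E₁, E₂, E₄] at hG
    refine (mul_eq_zero.1 ?_).resolve_left (pow_ne_zero 4 hne)
    rw [← hG]
    simp only [R]
    generalize e w₁ h = e₁
    generalize e w₂ h = e₂
    generalize e w₄ h = e₄
    simp only [x, w₁, w₂, w₄]
    ring
  have hlim : Tendsto (fun h => 4 * lam * (lam + 1) ^ 2 * (lam - 1) * (c₁ * c₃ - c₂ ^ 2) + h * R h)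
      (𝓝[≠] 0) (𝓝 (4 * lam * (lam + 1) ^ 2 * (lam - 1) * (c₁ * c₃ - c₂ ^ 2) + 0 * R 0)) :=
    (continuousAt_const.add (continuousAt_id.mul hR)).tendsto.mono_left nhdsWithin_le_nhds
  have hlast := tendsto_nhds_unique_of_eventuallyEq hlim tendsto_const_nhds hz
  rw [zero_mul, add_zero] at hlast
  have hne : 4 * lam * (lam + 1) ^ 2 * (lam - 1) ≠ 0 := by simp [h0, h1, h2]
  have := (mul_eq_zero.1 hlast).resolve_left hne
  linear_combination 12 * this - 12 * (c₂ + deriv (deriv f) p / 2) * hc₂ + 12 * c₁ * hc₃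

/-- An analytic function with nonzero derivative and zero Schwarzian on a ball is a Möbius map there:
the coefficients of its osculating Möbius map, suitably normalised, have derivative zero. -/
theorem exists_moebius_on_ball {f : ℂ → ℂ} {p : ℂ} {ε : ℝ} (hε : 0 < ε)
    (hf : AnalyticOnNhd ℂ f (Metric.ball p ε)) (hf' : ∀ z ∈ Metric.ball p ε, deriv f z ≠ 0)
    (hS : ∀ z ∈ Metric.ball p ε,
      2 * deriv f z * deriv (deriv (deriv f)) z = 3 * deriv (deriv f) z ^ 2) :
    ∃ a b c d : ℂ, a * d - b * c ≠ 0 ∧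
      ∀ z ∈ Metric.ball p ε, (c * z + d) * f z = a * z + b := by
  set B := Metric.ball p ε
  have hp : p ∈ B := Metric.mem_ball_self hε
  let s (z : ℂ) := deriv (deriv f) z / (2 * deriv f z)
  let m (z : ℂ) := (1 + (z - p) * s z) / deriv f z
  have df (z) (hz : z ∈ B) : HasDerivAt f (deriv f z) z :=
    (hf z hz).differentiableAt.hasDerivAt
  have df' (z) (hz : z ∈ B) : HasDerivAt (deriv f) (2 * s z * deriv f z) z := by
    refine HasDerivAt.congr_deriv ((hf z hz).deriv.differentiableAt.hasDerivAt) ?_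
    have := hf' z hz
    simp only [s]; field_simp
  have ds (z) (hz : z ∈ B) : HasDerivAt s (s z ^ 2) z := by
    have h0 := hf' z hz
    have := (hf z hz).deriv.deriv.differentiableAt.hasDerivAt.div
      ((hf z hz).deriv.differentiableAt.hasDerivAt.const_mul 2) (mul_ne_zero two_ne_zero h0)
    refine HasDerivAt.congr_deriv (this) ?_
    simp only [s]
    field_simp
    linear_combination hS z hz
  have du (z : ℂ) : HasDerivAt (fun z : ℂ => z - p) 1 z := (hasDerivAt_id z).sub_const p
  have dm (z) (hz : z ∈ B) : HasDerivAt m (-s z * m z) z := by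
    have h0 := hf' z hz
    refine HasDerivAt.congr_deriv ((((du z).mul (ds z hz)).const_add 1).div (df' z hz) h0) ?_
    simp only [m, Pi.mul_apply]
    field_simp
    ring
  have const (g : ℂ → ℂ) (hg : ∀ z ∈ B, HasDerivAt g 0 z) (z) (hz : z ∈ B) : g z = g p :=
    Metric.isOpen_ball.is_const_of_deriv_eq_zero (convex_ball p ε).isPreconnected
      (fun z hz => (hg z hz).differentiableAt.differentiableWithinAt)
      (fun z hz => (hg z hz).deriv) hz hp
  have hC := const (fun z => s z * m z) fun z hz => by
    refine HasDerivAt.congr_deriv ((ds z hz).mul (dm z hz)) ?_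
    ring
  have hE := const (fun z => (1 + (z - p) * s z) * m z) fun z hz => by
    refine HasDerivAt.congr_deriv ((((du z).mul (ds z hz)).const_add 1).mul (dm z hz)) ?_
    simp only [Pi.mul_apply]
    ring
  have hA := const (fun z => (deriv f z - f z * s z) * m z) fun z hz => by
    refine HasDerivAt.congr_deriv (((df' z hz).sub ((df z hz).mul (ds z hz))).mul (dm z hz)) ?_
    simp only [Pi.mul_apply, Pi.sub_apply]
    ring
  have hB := const (fun z => (f z * (1 + (z - p) * s z) - (z - p) * deriv f z) * m z)
    fun z hz => by
    refine HasDerivAt.congr_deriv ((((df z hz).mul (((du z).mul (ds z hz)).const_add 1)).sub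
      ((du z).mul (df' z hz))).mul (dm z hz)) ?_
    simp only [Pi.mul_apply, Pi.sub_apply]
    ring
  have hmp : m p ≠ 0 := by simpa [m] using hf' p hp
  refine ⟨(deriv f p - f p * s p) * m p, f p * m p - (deriv f p - f p * s p) * m p * p,
    -(s p * m p), m p + s p * m p * p, ?_, fun z hz => ?_⟩
  · rw [show (deriv f p - f p * s p) * m p * (m p + s p * m p * p)
      - (f p * m p - (deriv f p - f p * s p) * m p * p) * -(s p * m p)
      = deriv f p * m p ^ 2 by ring]
    exact mul_ne_zero (hf' p hp) (pow_ne_zero 2 hmp)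
  · have eC := hC z hz
    have eE := hE z hz
    have eA := hA z hz
    have eB := hB z hz
    simp only [sub_self, zero_mul, add_zero, mul_one, one_mul, sub_zero] at eC eE eA eB
    linear_combination (z - p) * f z * eC - f z * eE + (z - p) * eA + eB

/-- An injective analytic function on a domain with vanishing Schwarzian is a Möbius map. -/
theorem exists_moebius_of_schwarzian_eq_zero {U : Set ℂ} (hUne : U.Nonempty) (hUopen : IsOpen U)
    (hUconn : IsConnected U) {f : ℂ → ℂ} (hinj : Set.InjOn f U) (hf : AnalyticOnNhd ℂ f U)
    (hS : ∀ z ∈ U, 2 * deriv f z * deriv (deriv (deriv f)) z = 3 * deriv (deriv f) z ^ 2) :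
    ∃ a b c d : ℂ, a * d - b * c ≠ 0 ∧
      ∀ z ∈ U, c * z + d ≠ 0 ∧ f z = (a * z + b) / (c * z + d) := by
  obtain ⟨p, hp, hp'⟩ : ∃ p ∈ U, deriv f p ≠ 0 := by
    by_contra! hzero
    obtain ⟨q, hq⟩ := hUne
    obtain ⟨x, hx, hxq⟩ := (infinite_of_mem_nhds q (hUopen.mem_nhds hq)).nontrivial.exists_ne q
    exact hxq (hinj hx hq (hUopen.is_const_of_deriv_eq_zero hUconn.isPreconnected
      hf.differentiableOn hzero hx hq))
  obtain ⟨ε, hε, hball⟩ := Metric.eventually_nhds_iff_ball.1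
    ((hUopen.eventually_mem hp).and ((hf p hp).deriv.continuousAt.eventually_ne hp'))
  obtain ⟨a, b, c, d, hdet, heq⟩ := exists_moebius_on_ball hε
    (hf.mono fun z hz => (hball z hz).1) (fun z hz => (hball z hz).2)
    fun z hz => hS z (hball z hz).1
  have hU : Set.EqOn (fun z => (c * z + d) * f z) (fun z => a * z + b) U :=
    AnalyticOnNhd.eqOn_of_preconnected_of_eventuallyEq
      (fun z hz => (by fun_prop : AnalyticAt ℂ (fun z : ℂ => c * z + d) z).mul (hf z hz))
      (fun z hz => by fun_prop) hUconn.isPreconnected hp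
      (Metric.eventually_nhds_iff_ball.2 ⟨ε, hε, heq⟩)
  refine ⟨a, b, c, d, hdet, fun z hz => ?_⟩
  have e : (c * z + d) * f z = a * z + b := hU hz
  have hne : c * z + d ≠ 0 := by
    intro h0
    rw [h0, zero_mul] at e
    have hc : c = 0 := by
      refine (mul_eq_zero.1 ?_).resolve_left hdet
      linear_combination a * c * h0 + c * c * e
    exact hdet (by rw [hc] at h0 ⊢; linear_combination a * h0)
  exact ⟨hne, by rw [eq_div_iff hne, mul_comm, e]⟩

end


theorem kobayashi_theorem
    (lam : ℂ) (hlam : lam ∉ Set.range ((↑) : ℝ → ℂ))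
    (U : Set ℂ) (hUne : U.Nonempty) (hUopen : IsOpen U) (hUconn : IsConnected U)
    (f : ℂ → ℂ) (hinj : Set.InjOn f U)
    (hdiff : ∀ z ∈ U, DifferentiableAt ℝ f z)
    (hφ : ∀ z₁ ∈ U, ∀ z₂ ∈ U, ∀ z₃ ∈ U, ∀ z₄ ∈ U,
      z₁ ≠ z₂ → z₁ ≠ z₃ → z₁ ≠ z₄ → z₂ ≠ z₃ → z₂ ≠ z₄ → z₃ ≠ z₄ →
      (z₁ - z₃) * (z₂ - z₄) = lam * ((z₃ - z₂) * (z₄ - z₁)) →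
      (f z₁ - f z₃) * (f z₂ - f z₄) = lam * ((f z₃ - f z₂) * (f z₄ - f z₁))) :
    ∃ a b c d : ℂ, a * d - b * c ≠ 0 ∧
      ∀ z ∈ U, c * z + d ≠ 0 ∧ f z = (a * z + b) / (c * z + d) := by
  have hf : AnalyticOnNhd ℂ f U := DifferentiableOn.analyticOnNhd (fun z hz =>
    (differentiableAt_complex_of_relation hlam (hdiff z hz)
      (eventually_relation hlam hUopen hφ hz)).differentiableWithinAt) hUopen
  exact exists_moebius_of_schwarzian_eq_zero hUne hUopen hUconn hinj hf fun z hz =>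
    schwarzian_eq_zero_of_relation hlam (hf z hz) (eventually_relation hlam hUopen hφ hz)
end
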